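/- arXiv:1902.02998 — 2 statements merged into one kernel-verified Lean document; each statement's English description precedes it below -/
import Mathlib

section
/- If L is a locally uniform 2-lobster of length k ≥ 1 and f is an optimal independent broadcast on L, then there exists an optimal independent broadcast f̃ on L such that f̃*(S_i) > 0 for every i with 0 ≤ i ≤ k, i.e., every spine-subtree of L contains an f̃-broadcast vertex. -/
noncomputable section

open scoped Classical

variable {V : Type*}

/-- A pendent vertex (leaf): a vertex with exactly one neighbour. -/
def SimpleGraph.IsLeafVert (G : SimpleGraph V) (v : V) : Prop :=
  (G.neighborSet v).ncard = 1

/-- The eccentricity of a vertex: the maximum distance from it to any vertex. -/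
def ecc [Fintype V] (G : SimpleGraph V) (v : V) : ℕ :=
  Finset.univ.sup fun u => G.dist v u

/-- The diameter of a graph: the maximum eccentricity. -/
def gdiam [Fintype V] (G : SimpleGraph V) : ℕ :=
  Finset.univ.sup fun v => ecc G v

/-- A broadcast on `G`: `f v ≤ e_G(v)` for every vertex `v`. -/
def IsBroadcast [Fintype V] (G : SimpleGraph V) (f : V → ℕ) : Prop :=
  ∀ v, f v ≤ ecc G v

/-- The cost of a broadcast. -/
def bcost [Fintype V] (f : V → ℕ) : ℕ :=
  ∑ v, f v

/-- An independent broadcast: a broadcast such that every two distinct broadcast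
vertices `u, v` satisfy `d_G(u,v) > max (f u) (f v)`. -/
def IsIndepBroadcast [Fintype V] (G : SimpleGraph V) (f : V → ℕ) : Prop :=
  IsBroadcast G f ∧
    ∀ u v : V, u ≠ v → 0 < f u → 0 < f v → max (f u) (f v) < G.dist u v

/-- The broadcast independence number: maximum cost of an independent broadcast. -/
def betaB [Fintype V] (G : SimpleGraph V) : ℕ :=
  sSup {c : ℕ | ∃ f : V → ℕ, IsIndepBroadcast G f ∧ bcost f = c}

/-- A dominating broadcast: every vertex is within distance `f u` of some
broadcast vertex `u`. -/
def IsDominatingBroadcast [Fintype V] (G : SimpleGraph V) (f : V → ℕ) : Prop :=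
  ∀ w : V, ∃ u : V, 0 < f u ∧ G.dist u w ≤ f u

/-- A graph is a (nonempty) path graph if its vertices can be enumerated
`w_0, …, w_n` with adjacency exactly between consecutive vertices. -/
def IsPathGraph {W : Type*} (P : SimpleGraph W) : Prop :=
  ∃ (n : ℕ) (e : W ≃ Fin (n + 1)),
    ∀ a b : W, P.Adj a b ↔ ((e a : ℕ) + 1 = (e b : ℕ) ∨ (e b : ℕ) + 1 = (e a : ℕ))

/-- The set of non-leaf vertices. -/
def nonleaves (G : SimpleGraph V) : Set V :=
  {v | ¬ G.IsLeafVert v}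

/-- The graph obtained from `G` by deleting all its leaves. -/
def pruned (G : SimpleGraph V) : SimpleGraph (nonleaves G) :=
  SimpleGraph.induce (nonleaves G) G

/-- A caterpillar: a tree such that deleting all leaves yields a nonempty path. -/
def IsCaterpillar (G : SimpleGraph V) : Prop :=
  G.IsTree ∧ IsPathGraph (pruned G)

/-- A lobster: a tree such that deleting all leaves yields a caterpillar. -/
def IsLobster (G : SimpleGraph V) : Prop :=
  G.IsTree ∧ IsCaterpillar (pruned G)

/-- The set of spine vertices of a lobster: the vertices remaining after
deleting all leaves and then all leaves of the resulting caterpillar. -/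
def spineSet (G : SimpleGraph V) : Set V :=
  {x | ∃ h : x ∈ nonleaves G, (⟨x, h⟩ : nonleaves G) ∈ nonleaves (pruned G)}

/-- An enumeration `v 0, …, v k` of the spine of a lobster as a path. -/
structure SpineEnum (G : SimpleGraph V) (k : ℕ) where
  v : ℕ → V
  inj : ∀ i ≤ k, ∀ j ≤ k, v i = v j → i = j
  mem : ∀ x : V, x ∈ spineSet G ↔ ∃ i ≤ k, v i = x
  adj : ∀ i ≤ k, ∀ j ≤ k, (G.Adj (v i) (v j) ↔ i + 1 = j ∨ j + 1 = i)

/-- The graph obtained from `G` by deleting all spine edges. -/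
def offSpine (G : SimpleGraph V) : SimpleGraph V :=
  G.deleteEdges {e : Sym2 V | ∀ x ∈ e, x ∈ spineSet G}

/-- The vertex set of the spine-subtree rooted at `u`: the connected component
of `u` after deleting all spine edges. -/
def Ssub (G : SimpleGraph V) (u : V) : Set V :=
  {x | (offSpine G).Reachable u x}

/-- `f*(S_u)`: the sum of the values of `f` on the spine-subtree rooted at `u`. -/
def fstar (G : SimpleGraph V) (f : V → ℕ) (u : V) : ℕ :=
  ∑ᶠ x ∈ Ssub G u, f x

/-- A spine-subtree rooted at `u` is of type S1 if every leaf in it is at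
distance 1 from `u`. -/
def typeS1 (G : SimpleGraph V) (u : V) : Prop :=
  ∀ x ∈ Ssub G u, G.IsLeafVert x → G.dist u x = 1

/-- A spine-subtree rooted at `u` is of type S2 if every leaf in it is at
distance 2 from `u`. -/
def typeS2 (G : SimpleGraph V) (u : V) : Prop :=
  ∀ x ∈ Ssub G u, G.IsLeafVert x → G.dist u x = 2

/-- A lobster is locally uniform if every spine-subtree is of type S1 or S2. -/
def LocallyUniform (G : SimpleGraph V) {k : ℕ} (s : SpineEnum G k) : Prop :=
  ∀ i ≤ k, typeS1 G (s.v i) ∨ typeS2 G (s.v i)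

/-- The roots of the branches of the spine-subtree rooted at `u`:
the non-spine neighbours of `u`. -/
def branchRoots (G : SimpleGraph V) (u : V) : Set V :=
  (offSpine G).neighborSet u

/-- A 2-lobster: every spine-subtree has at least two branches. -/
def IsTwoLobster (G : SimpleGraph V) {k : ℕ} (s : SpineEnum G k) : Prop :=
  ∀ i ≤ k, 2 ≤ (branchRoots G (s.v i)).ncard

/-- The 1-leaves of the spine-subtree rooted at `u`. -/
def oneLeaves (G : SimpleGraph V) (u : V) : Set V :=
  {x | x ∈ Ssub G u ∧ G.IsLeafVert x ∧ G.dist u x = 1}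

/-- The 2-leaves of the spine-subtree rooted at `u`. -/
def twoLeaves (G : SimpleGraph V) (u : V) : Set V :=
  {x | x ∈ Ssub G u ∧ G.IsLeafVert x ∧ G.dist u x = 2}

/-- An only-leaf: a leaf whose neighbour has exactly one leaf neighbour. -/
def IsOnlyLeaf (G : SimpleGraph V) (x : V) : Prop :=
  G.IsLeafVert x ∧ ∀ y : V, G.Adj x y → {z | G.Adj y z ∧ G.IsLeafVert z}.ncard = 1

/-- The 2-only-leaves of the spine-subtree rooted at `u`. -/
def twoOnlyLeaves (G : SimpleGraph V) (u : V) : Set V :=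
  {x | x ∈ twoLeaves G u ∧ IsOnlyLeaf G x}

/-- `λ1(S_u)`: the number of 1-leaves of the spine-subtree rooted at `u`. -/
def lam1 (G : SimpleGraph V) (u : V) : ℕ := (oneLeaves G u).ncard

/-- `λ2(S_u)`: the number of 2-leaves of the spine-subtree rooted at `u`. -/
def lam2 (G : SimpleGraph V) (u : V) : ℕ := (twoLeaves G u).ncard

/-- `λ2*(S_u)`: the number of 2-only-leaves of the spine-subtree rooted at `u`. -/
def lam2star (G : SimpleGraph V) (u : V) : ℕ := (twoOnlyLeaves G u).ncard

/-- The 2-leaves of the branch of `S_u` rooted at the neighbour `w` of `u`. -/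
def branchTwoLeaves (G : SimpleGraph V) (u w : V) : Set V :=
  {x | G.Adj w x ∧ x ≠ u ∧ G.IsLeafVert x}

/-- The branches of `S_u` having at most two 2-leaves. -/
def smallBranches (G : SimpleGraph V) (u : V) : Set V :=
  {w | w ∈ branchRoots G u ∧ (branchTwoLeaves G u w).ncard ≤ 2}

/-- `α2*(S_u)`: the number of branches of `S_u` containing no 1-leaf
(type B2) and having at most two 2-leaves. -/
def alpha2star (G : SimpleGraph V) (u : V) : ℕ :=
  {w | w ∈ branchRoots G u ∧ ¬ G.IsLeafVert w ∧
    (branchTwoLeaves G u w).ncard ≤ 2}.ncard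

/-- Type F_A: type S2 and every branch has at least three 2-leaves. -/
def typeFA (G : SimpleGraph V) (u : V) : Prop :=
  typeS2 G u ∧ ∀ w ∈ branchRoots G u, 3 ≤ (branchTwoLeaves G u w).ncard

/-- Type X_a: type S1 with at least three leaves. -/
def typeXa (G : SimpleGraph V) (u : V) : Prop :=
  typeS1 G u ∧ 3 ≤ lam1 G u

/-- Type X_b: type S2 with exactly one branch having at most two 2-leaves. -/
def typeXb (G : SimpleGraph V) (u : V) : Prop :=
  typeS2 G u ∧ (smallBranches G u).ncard = 1

/-- Type Y_C: type S2 with at least two branches having at most two 2-leaves. -/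
def typeYc (G : SimpleGraph V) (u : V) : Prop :=
  typeS2 G u ∧ 2 ≤ (smallBranches G u).ncard

/-- Type G: type S1 with exactly two leaves, having at least one neighbouring
spine-subtree of type S1. -/
def typeG' (G : SimpleGraph V) {k : ℕ} (s : SpineEnum G k) (i : ℕ) : Prop :=
  typeS1 G (s.v i) ∧ lam1 G (s.v i) = 2 ∧
    ((0 < i ∧ typeS1 G (s.v (i - 1))) ∨ (i < k ∧ typeS1 G (s.v (i + 1))))

/-- Type X_c: type S1 with exactly two leaves, both neighbouring spine-subtrees
existing and being of type S2. -/
def typeXc (G : SimpleGraph V) {k : ℕ} (s : SpineEnum G k) (i : ℕ) : Prop :=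
  typeS1 G (s.v i) ∧ lam1 G (s.v i) = 2 ∧
    0 < i ∧ i < k ∧ typeS2 G (s.v (i - 1)) ∧ typeS2 G (s.v (i + 1))

/-- Type X: type X_a, X_b or X_c. -/
def typeX (G : SimpleGraph V) {k : ℕ} (s : SpineEnum G k) (i : ℕ) : Prop :=
  typeXa G (s.v i) ∨ typeXb G (s.v i) ∨ typeXc G s i

/-- Type F_A, G or X_a. -/
def FGXa (G : SimpleGraph V) {k : ℕ} (s : SpineEnum G k) (i : ℕ) : Prop :=
  typeFA G (s.v i) ∨ typeG' G s i ∨ typeXa G (s.v i)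

/-- The sequence of spine-subtrees `S i, S (i+1), …, S (i + 2*j)` is of type T_4. -/
def isT4 (G : SimpleGraph V) {k : ℕ} (s : SpineEnum G k) (i j : ℕ) : Prop :=
  i + 2 * j ≤ k ∧
  (∀ m ≤ j, typeFA G (s.v (i + 2 * m))) ∧
  (∀ m < j, typeX G s (i + 2 * m + 1) ∨ typeFA G (s.v (i + 2 * m + 1))) ∧
  (¬ (2 ≤ i ∧ typeFA G (s.v (i - 2)) ∧
      (typeX G s (i - 1) ∨ typeFA G (s.v (i - 1))))) ∧
  (¬ (i + 2 * j + 2 ≤ k ∧ typeFA G (s.v (i + 2 * j + 2)) ∧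
      (typeX G s (i + 2 * j + 1) ∨ typeFA G (s.v (i + 2 * j + 1))))) ∧
  (1 ≤ i → FGXa G s (i - 1)) ∧
  (2 ≤ i → ¬ typeXc G s (i - 2)) ∧
  (i + 2 * j + 1 ≤ k → FGXa G s (i + 2 * j + 1)) ∧
  (i + 2 * j + 2 ≤ k → ¬ typeXc G s (i + 2 * j + 2))

/-- The spine-subtree `S i` belongs to some sequence of type T_4. -/
def inT4 (G : SimpleGraph V) {k : ℕ} (s : SpineEnum G k) (i : ℕ) : Prop :=
  ∃ a j, isT4 G s a j ∧ a ≤ i ∧ i ≤ a + 2 * j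

/-- The spine-subtree `S i` appears as an F_A-spine-subtree (even offset)
in some sequence of type T_4. -/
def inT4asFA (G : SimpleGraph V) {k : ℕ} (s : SpineEnum G k) (i : ℕ) : Prop :=
  ∃ a j, isT4 G s a j ∧ ∃ m ≤ j, i = a + 2 * m

/-- The 1-leaves of the lobster `G`: leaves adjacent to a spine vertex. -/
def oneLeavesL (G : SimpleGraph V) : Set V :=
  {x | G.IsLeafVert x ∧ ∃ u ∈ spineSet G, G.Adj u x}

/-- The 2-leaves of the lobster `G`: leaves not adjacent to any spine vertex
(i.e. at distance 2 from their nearest spine vertex). -/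
def twoLeavesL (G : SimpleGraph V) : Set V :=
  {x | G.IsLeafVert x ∧ ¬ ∃ u ∈ spineSet G, G.Adj u x}

/-- `λ1(L)`: the number of 1-leaves of `G`. -/
def lam1L (G : SimpleGraph V) : ℕ := (oneLeavesL G).ncard

/-- `λ2(L)`: the number of 2-leaves of `G`. -/
def lam2L (G : SimpleGraph V) : ℕ := (twoLeavesL G).ncard

/-- `λ2*(L)`: the number of 2-only-leaves of `G`. -/
def lam2starL (G : SimpleGraph V) : ℕ :=
  {x | x ∈ twoLeavesL G ∧ IsOnlyLeaf G x}.ncard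

/-- `ν2(L)`: the number of branches having at most two 2-leaves that belong
to spine-subtrees of type S2. -/
def nu2 (G : SimpleGraph V) {k : ℕ} (s : SpineEnum G k) : ℕ :=
  ∑ i ∈ Finset.range (k + 1),
    if typeS2 G (s.v i) then (smallBranches G (s.v i)).ncard else 0

/-- `ν3(L)`: the number of spine-subtrees of type X_c. -/
def nu3 (G : SimpleGraph V) {k : ℕ} (s : SpineEnum G k) : ℕ :=
  ((Finset.range (k + 1)).filter (fun i => typeXc G s i)).card

/-- `ν4(L)`: the sum over all sequences of type T_4 of
`(j + 1) - #(spine-subtrees of type X_b or X_c in the sequence)`. -/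
def nu4 (G : SimpleGraph V) {k : ℕ} (s : SpineEnum G k) : ℕ :=
  ∑ i ∈ Finset.range (k + 1), ∑ j ∈ Finset.range (k + 1),
    if isT4 G s i j then
      (j + 1) - ((Finset.range (2 * j + 1)).filter
        (fun m => typeXb G (s.v (i + m)) ∨ typeXc G s (i + m))).card
    else 0

/-- `β*(L) = ν1(L) + ν2(L) + ν3(L) + ν4(L)` where
`ν1(L) = λ1(L) + λ2(L) + λ2*(L)`. -/
def betaStar (G : SimpleGraph V) {k : ℕ} (s : SpineEnum G k) : ℕ :=
  (lam1L G + lam2L G + lam2starL G) + nu2 G s + nu3 G s + nu4 G s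


set_option linter.unusedSimpArgs false

lemma lob_right (k j n : ℕ) (w : ℕ → ℕ) (hw : ∀ i, 1 ≤ w i) (hk : 3 ≤ w k) (hj : j < k)
    (P : ℕ → Prop) [DecidablePred P] (hP : ∀ i, j < i → i ≤ k → i ≤ j + n → P i) :
    min (k - j + 2) n ≤ ∑ i ∈ (Finset.Ioc j k).filter P, w i := by
  by_cases h : j + n ≤ k
  · have hsub : Finset.Ioc j (j + n) ⊆ (Finset.Ioc j k).filter P := by
      intro i hi
      simp only [Finset.mem_Ioc, Finset.mem_filter] at hi ⊢
      exact ⟨by omega, hP i (by omega) (by omega) (by omega)⟩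
    have h1 := Finset.sum_le_sum_of_subset (f := w) hsub
    have h2 : (Finset.Ioc j (j + n)).card • 1 ≤ ∑ i ∈ Finset.Ioc j (j + n), w i :=
      Finset.card_nsmul_le_sum _ w 1 (fun i _ => hw i)
    simp only [Nat.card_Ioc, Nat.card_Ico, smul_eq_mul, mul_one] at h2
    omega
  · have hsub : Finset.Ioc j k ⊆ (Finset.Ioc j k).filter P := by
      intro i hi
      simp only [Finset.mem_Ioc, Finset.mem_filter] at hi ⊢
      exact ⟨by omega, hP i (by omega) (by omega) (by omega)⟩
    have h1 := Finset.sum_le_sum_of_subset (f := w) hsub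
    have hins : Finset.Ioc j k = insert k (Finset.Ioc j (k - 1)) := by
      ext i; simp only [Finset.mem_Ioc, Finset.mem_insert]; omega
    have h2 : (Finset.Ioc j (k - 1)).card • 1 ≤ ∑ i ∈ Finset.Ioc j (k - 1), w i :=
      Finset.card_nsmul_le_sum _ w 1 (fun i _ => hw i)
    have h3 : ∑ i ∈ Finset.Ioc j k, w i = w k + ∑ i ∈ Finset.Ioc j (k - 1), w i := by
      rw [hins, Finset.sum_insert]
      simp only [Finset.mem_Ioc]; omega
    simp only [Nat.card_Ioc, Nat.card_Ico, smul_eq_mul, mul_one] at h2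
    omega

lemma lob_left (j n : ℕ) (w : ℕ → ℕ) (hw : ∀ i, 1 ≤ w i) (hk : 3 ≤ w 0) (hj : 0 < j)
    (P : ℕ → Prop) [DecidablePred P] (hP : ∀ i, i < j → j ≤ i + n → P i) :
    min (j + 2) n ≤ ∑ i ∈ (Finset.range j).filter P, w i := by
  by_cases h : n ≤ j
  · have hsub : Finset.Ico (j - n) j ⊆ (Finset.range j).filter P := by
      intro i hi
      simp only [Finset.mem_Ico, Finset.mem_range, Finset.mem_filter] at hi ⊢
      exact ⟨by omega, hP i (by omega) (by omega)⟩
    have h1 := Finset.sum_le_sum_of_subset (f := w) hsub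
    have h2 : (Finset.Ico (j - n) j).card • 1 ≤ ∑ i ∈ Finset.Ico (j - n) j, w i :=
      Finset.card_nsmul_le_sum _ w 1 (fun i _ => hw i)
    simp only [Nat.card_Ioc, Nat.card_Ico, smul_eq_mul, mul_one] at h2
    omega
  · have hsub : Finset.range j ⊆ (Finset.range j).filter P := by
      intro i hi
      simp only [Finset.mem_range, Finset.mem_filter] at hi ⊢
      exact ⟨by omega, hP i (by omega) (by omega)⟩
    have h1 := Finset.sum_le_sum_of_subset (f := w) hsub
    have hins : Finset.range j = insert 0 (Finset.Ico 1 j) := by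
      ext i; simp only [Finset.mem_Ico, Finset.mem_range, Finset.mem_insert]; omega
    have h2 : (Finset.Ico 1 j).card • 1 ≤ ∑ i ∈ Finset.Ico 1 j, w i :=
      Finset.card_nsmul_le_sum _ w 1 (fun i _ => hw i)
    have h3 : ∑ i ∈ Finset.range j, w i = w 0 + ∑ i ∈ Finset.Ico 1 j, w i := by
      rw [hins, Finset.sum_insert]
      simp
    simp only [Nat.card_Ioc, Nat.card_Ico, smul_eq_mul, mul_one] at h2
    omega

lemma lob_count (k j m e : ℕ) (d : ℕ → ℕ) (hd : ∀ i, d i = 1 ∨ d i = 2) (h0 : d 0 = 2)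
    (hk : d k = 2) (hj : j ≤ k) (he : e ≤ d j) (i0 : ℕ) (hi0 : i0 ≤ k)
    (hm : m ≤ (i0 - j) + (j - i0) + e + d i0)
    (hex : ¬ (d j = 1 ∧ e = 1 ∧ m = 3 ∧ d (j - 1) = 2 ∧ d (j + 1) = 2)) :
    m ≤ 2 * (2 * d j - 1) + ∑ i ∈ (Finset.range (k + 1)).filter
      (fun i => i ≠ j ∧ (i - j) + (j - i) + e + d i ≤ m), (2 * d i - 1) := by
  set P : ℕ → Prop := fun i => (i - j) + (j - i) + e + d i ≤ m with hPdef
  have hsplit : ∑ i ∈ (Finset.range (k + 1)).filter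
      (fun i => i ≠ j ∧ (i - j) + (j - i) + e + d i ≤ m), (2 * d i - 1)
      = ∑ i ∈ (Finset.range j).filter P, (2 * d i - 1)
        + ∑ i ∈ (Finset.Ioc j k).filter P, (2 * d i - 1) := by
    rw [← Finset.sum_union]
    · apply Finset.sum_congr _ (fun _ _ => rfl)
      ext i
      simp only [Finset.mem_filter, Finset.mem_range, Finset.mem_union, Finset.mem_Ioc, hPdef]
      constructor
      · rintro ⟨h1, h2, h3⟩
        by_cases h : i < j
        · exact Or.inl ⟨h, h3⟩
        · exact Or.inr ⟨⟨by omega, by omega⟩, h3⟩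
      · rintro (⟨h1, h3⟩ | ⟨h1, h3⟩)
        · exact ⟨by omega, by omega, h3⟩
        · exact ⟨by omega, by omega, h3⟩
    · rw [Finset.disjoint_left]
      intro i
      simp only [Finset.mem_filter, Finset.mem_range, Finset.mem_Ioc]
      omega
  rw [hsplit]
  have hw : ∀ i, 1 ≤ 2 * d i - 1 := fun i => by have := hd i; omega
  have hR : j < k → min (k - j + 2) (m - e - 2)
      ≤ ∑ i ∈ (Finset.Ioc j k).filter P, (2 * d i - 1) := fun h =>
    lob_right k j (m - e - 2) (fun i => 2 * d i - 1) hw (by simp [hk]) h P (by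
      intro i h1 h2 h3; have := hd i; simp only [hPdef]; omega)
  have hLt : 0 < j → min (j + 2) (m - e - 2)
      ≤ ∑ i ∈ (Finset.range j).filter P, (2 * d i - 1) := fun h =>
    lob_left j (m - e - 2) (fun i => 2 * d i - 1) hw (by simp [h0]) h P (by
      intro i h1 h2; have := hd i; simp only [hPdef]; omega)
  have hR1 : j < k → P (j + 1) → 1 ≤ ∑ i ∈ (Finset.Ioc j k).filter P, (2 * d i - 1) := by
    intro h hp
    refine (hw (j + 1)).trans (Finset.single_le_sum (f := fun i => 2 * d i - 1)
      (fun _ _ => Nat.zero_le _) ?_)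
    simp only [Finset.mem_filter, Finset.mem_Ioc]
    exact ⟨by omega, hp⟩
  have hL1 : 0 < j → P (j - 1) → 1 ≤ ∑ i ∈ (Finset.range j).filter P, (2 * d i - 1) := by
    intro h hp
    refine (hw (j - 1)).trans (Finset.single_le_sum (f := fun i => 2 * d i - 1)
      (fun _ _ => Nat.zero_le _) ?_)
    simp only [Finset.mem_filter, Finset.mem_range]
    exact ⟨by omega, hp⟩
  have hdi := hd i0
  rcases hd j with hdj | hdj
  · have hj0 : 0 < j := by
      rcases Nat.eq_zero_or_pos j with h | h
      · subst h; omega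
      · exact h
    have hjk : j < k := by
      rcases Nat.lt_or_ge j k with h | h
      · exact h
      · have : j = k := by omega
        subst this; omega
    specialize hR hjk
    specialize hLt hj0
    specialize hR1 hjk
    specialize hL1 hj0
    simp only [hPdef] at hR1 hL1
    generalize ∑ i ∈ (Finset.Ioc j k).filter P, (2 * d i - 1) = R at *
    generalize ∑ i ∈ (Finset.range j).filter P, (2 * d i - 1) = L at *
    have e1 := hd (j - 1)
    have e2 := hd (j + 1)
    by_cases hx : e = 1 ∧ m = 3
    · obtain ⟨rfl, rfl⟩ := hx
      by_cases hq : d (j - 1) = 1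
      · have := hL1 (by omega); omega
      · have := hR1 (by omega); omega
    · omega
  · clear hR1 hL1 hsplit hex
    generalize ∑ i ∈ (Finset.Ioc j k).filter P, (2 * d i - 1) = R at *
    generalize ∑ i ∈ (Finset.range j).filter P, (2 * d i - 1) = L at *
    rcases Nat.lt_trichotomy i0 j with h | h | h
    · specialize hLt (by omega); omega
    · subst h; omega
    · specialize hR (by omega); omega

set_option maxHeartbeats 2000000 in
lemma lob_main [Fintype V] (G : SimpleGraph V) (k : ℕ) (r δ : V → ℕ) (d : ℕ → ℕ)
    (hd : ∀ i, d i = 1 ∨ d i = 2) (h0 : d 0 = 2) (hk : d k = 2)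
    (hr : ∀ x, r x ≤ k) (hδ : ∀ x, δ x ≤ d (r x))
    (hub : ∀ x y, G.dist x y ≤ (r x - r y) + (r y - r x) + δ x + δ y)
    (heq : ∀ x y, r x ≠ r y → G.dist x y = (r x - r y) + (r y - r x) + δ x + δ y)
    (p q : ℕ → V) (hp : ∀ i ≤ k, r (p i) = i ∧ δ (p i) = d i)
    (hq : ∀ i ≤ k, r (q i) = i ∧ δ (q i) = d i)
    (hpq : ∀ i ≤ k, G.dist (p i) (q i) = 2 * d i)
    (f : V → ℕ) (hf : IsIndepBroadcast G f)
    (hopt : ∀ g : V → ℕ, IsIndepBroadcast G g → bcost g ≤ bcost f) :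
    ∃ g : V → ℕ, IsIndepBroadcast G g ∧ bcost f ≤ bcost g ∧
      ∀ i ≤ k, ∃ x, r x = i ∧ 0 < g x := by
  obtain ⟨hfb, hfi⟩ := hf
  have hfi' : ∀ u v, u ≠ v → 0 < f u → 0 < f v → f u < G.dist u v := fun u v h1 h2 h3 =>
    lt_of_le_of_lt (le_max_left _ _) (hfi u v h1 h2 h3)
  have hdom : ∀ u v, 0 < f u → G.dist u v ≤ f u → u ≠ v → f v = 0 := by
    intro u v h1 h2 h3
    by_contra h4
    have := hfi' u v h3 h1 (Nat.pos_of_ne_zero h4)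
    omega
  have hecc : ∀ u v, G.dist u v ≤ ecc G u := fun u v =>
    Finset.le_sup (f := fun w => G.dist u w) (Finset.mem_univ v)
  have hpq' : ∀ i ≤ k, p i ≠ q i := by
    intro i hi h
    have h1 := hpq i hi
    rw [h, SimpleGraph.dist_self] at h1
    have := hd i
    omega
  let T : V → Prop := fun u => δ u + d (r u) ≤ f u ∧
    ¬ (d (r u) = 1 ∧ δ u = 1 ∧ f u = 3 ∧ d (r u - 1) = 2 ∧ d (r u + 1) = 2)
  let E : ℕ → Prop := fun i => ∀ x, r x = i → f x = 0
  let Z : ℕ → Prop := fun i => (∃ u, r u = i ∧ T u) ∨ E i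
  have hTpos : ∀ u, T u → 0 < f u := by
    intro u hu
    have := hd (r u)
    have := hu.1
    omega
  have hTuniq : ∀ u x, T u → r x = r u → x ≠ u → f x = 0 := by
    intro u x hu hx hne
    refine hdom u x (hTpos u hu) ?_ hne.symm
    have h1 := hub u x
    have h2 := hδ x
    have h3 := hu.1
    rw [hx] at h1 h2
    omega
  have hret : ∀ y, ¬ Z (r y) → f y < δ y + d (r y) ∨
      (d (r y) = 1 ∧ δ y = 1 ∧ f y = 3 ∧ d (r y - 1) = 2 ∧ d (r y + 1) = 2) := by
    intro y hy
    by_contra hcon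
    push Not at hcon
    apply hy
    left
    refine ⟨y, rfl, hcon.1, ?_⟩
    rintro ⟨a, b, c, e, g⟩
    exact hcon.2 a b c e g
  have hempty : ∀ i ≤ k, E i → ∀ z, r z = i → ∃ u, 0 < f u ∧ G.dist u z ≤ f u := by
    intro i hi hE z hz
    by_contra hcon
    push Not at hcon
    have hfz : f z = 0 := hE z hz
    have hg : IsIndepBroadcast G (Function.update f z 1) := by
      constructor
      · intro x
        by_cases hx : x = z
        · subst hx
          rw [Function.update_self]
          have : ∃ y, r y ≠ r x := by
            by_cases hx0 : r x = 0
            · refine ⟨p k, ?_⟩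
              rw [(hp k le_rfl).1]
              intro hk0
              have hz0 : ∀ y, f y = 0 := by
                intro y
                have := hr y
                exact hE y (by omega)
              have hk00 : k = 0 := by omega
              have e1 := hecc x (p 0)
              have e2 := hecc x (q 0)
              have e3 : ecc G x = 0 ∨ 1 ≤ ecc G x := by omega
              rcases e3 with e3 | e3
              · have hb : IsIndepBroadcast G (Function.update (fun _ => 0) (p 0) 1) := by
                  constructor
                  · intro y
                    by_cases hy : y = p 0
                    · subst hy
                      rw [Function.update_self]
                      have := hecc (p 0) (q 0)
                      have := hpq 0 (by omega)
                      omega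
                    · rw [Function.update_of_ne hy]; exact Nat.zero_le _
                  · intro u v huv hu hv
                    by_cases h1 : u = p 0
                    · by_cases h2 : v = p 0
                      · exact absurd (h1.trans h2.symm) huv
                      · rw [Function.update_of_ne h2] at hv; exact absurd hv (lt_irrefl _)
                    · rw [Function.update_of_ne h1] at hu; exact absurd hu (lt_irrefl _)
                have := hopt _ hb
                have h7 : bcost f = 0 := by simp [bcost, hz0]
                have h8 : bcost (Function.update (fun _ => 0) (p 0) 1 : V → ℕ) = 1 := by
                  unfold bcost
                  rw [Finset.sum_update_of_mem (Finset.mem_univ _)]; simp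
                omega
              · have hb : IsIndepBroadcast G (Function.update (fun _ => 0) x 1) := by
                  constructor
                  · intro y
                    by_cases hy : y = x
                    · subst hy
                      rw [Function.update_self]
                      exact e3
                    · rw [Function.update_of_ne hy]; exact Nat.zero_le _
                  · intro u v huv hu hv
                    by_cases h1 : u = x
                    · by_cases h2 : v = x
                      · exact absurd (h1.trans h2.symm) huv
                      · rw [Function.update_of_ne h2] at hv; exact absurd hv (lt_irrefl _)
                    · rw [Function.update_of_ne h1] at hu; exact absurd hu (lt_irrefl _)
                have := hopt _ hb
                have h7 : bcost f = 0 := by simp [bcost, hz0]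
                have h8 : bcost (Function.update (fun _ => 0) x 1 : V → ℕ) = 1 := by
                  unfold bcost
                  rw [Finset.sum_update_of_mem (Finset.mem_univ _)]; simp
                omega
            · exact ⟨p 0, by rw [(hp 0 (by omega)).1]; omega⟩
          obtain ⟨y, hy⟩ := this
          have h1 := heq x y (Ne.symm hy)
          have h2 := hecc x y
          omega
        · rw [Function.update_of_ne hx]; exact hfb x
      · intro u v huv hu hv
        by_cases h1 : u = z
        · subst h1
          have h2 : v ≠ u := huv.symm
          rw [Function.update_self, Function.update_of_ne h2]
          rw [Function.update_of_ne h2] at hv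
          have := hcon v hv
          rw [SimpleGraph.dist_comm]
          omega
        · by_cases h2 : v = z
          · subst h2
            rw [Function.update_self, Function.update_of_ne h1]
            rw [Function.update_of_ne h1] at hu
            have := hcon u hu
            omega
          · rw [Function.update_of_ne h1] at hu ⊢
            rw [Function.update_of_ne h2] at hv ⊢
            exact hfi u v huv hu hv
    have h1 := hopt _ hg
    have h2 : bcost (Function.update f z 1) = bcost f + 1 := by
      unfold bcost
      rw [Finset.sum_update_of_mem (Finset.mem_univ _), add_comm,
        ← Finset.sum_sdiff (Finset.subset_univ {z})]
      simp [hfz]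
    omega
  let g : V → ℕ := fun x => if Z (r x) then
    (if x = p (r x) ∨ x = q (r x) then 2 * d (r x) - 1 else 0) else f x
  have hgZ : ∀ x, Z (r x) → 0 < g x → (x = p (r x) ∨ x = q (r x)) ∧ g x = 2 * d (r x) - 1
      ∧ δ x = d (r x) := by
    intro x hx hgx
    simp only [g, if_pos hx] at hgx ⊢
    by_cases h : x = p (r x) ∨ x = q (r x)
    · refine ⟨h, if_pos h, ?_⟩
      rcases h with h | h
      · conv_lhs => rw [h]
        exact (hp _ (hr x)).2
      · conv_lhs => rw [h]
        exact (hq _ (hr x)).2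
    · rw [if_neg h] at hgx
      exact absurd hgx (lt_irrefl _)
  have hgn : ∀ x, ¬ Z (r x) → g x = f x := fun x hx => if_neg hx
  have hgp : ∀ i ≤ k, Z i → g (p i) = 2 * d i - 1 := by
    intro i hi hZ
    have h1 := (hp i hi).1
    simp only [g, h1, if_pos hZ]
    simp
  have hgq : ∀ i ≤ k, Z i → g (q i) = 2 * d i - 1 := by
    intro i hi hZ
    have h1 := (hq i hi).1
    simp only [g, h1, if_pos hZ]
    simp
  have hmix : ∀ x y, Z (r x) → ¬ Z (r y) → 0 < g x → 0 < f y →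
      g x < G.dist x y ∧ f y < G.dist x y := by
    intro x y hx hy hgx hfy
    obtain ⟨hxpq, hgx', hδx⟩ := hgZ x hx hgx
    have hne : r x ≠ r y := fun h => hy (h ▸ hx)
    have hdist := heq x y hne
    have hdx := hd (r x)
    have hdy := hd (r y)
    have hsm := hret y hy
    constructor
    · by_cases hc : d (r x) = 2 ∧ δ y = 0 ∧ (r x + 1 = r y ∨ r y + 1 = r x)
      · exfalso
        obtain ⟨hc1, hc2, hc3⟩ := hc
        rcases hx with ⟨u, hu, hTu⟩ | hE
        · have h1 := hub u y
          have h2 := hTu.1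
          rw [hu] at h1 h2
          have h3 : u ≠ y := fun h => hne (by rw [← hu, h])
          have := hdom u y (hTpos u hTu) (by omega) h3
          omega
        · obtain ⟨u, hu1, hu2⟩ := hempty (r x) (hr x) hE x rfl
          have hux : r u ≠ r x := fun h => by
            have := hE u h
            omega
          have h1 := heq u x hux
          have h2 := hub u y
          by_cases huy : u = y
          · subst huy
            omega
          · have := hdom u y hu1 (by omega) huy
            omega
      · omega
    · rcases hsm with hsm | ⟨a1, a2, a3, a4, a5⟩
      · omega
      · by_cases b1 : r x + 1 = r y
        · have : r y - 1 = r x := by omega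
          rw [this] at a4
          omega
        · by_cases b2 : r x = r y + 1
          · rw [← b2] at a5
            omega
          · omega
  have hgind : ∀ u v, u ≠ v → 0 < g u → 0 < g v → g u < G.dist u v := by
    intro u v huv hu hv
    by_cases h1 : Z (r u)
    · by_cases h2 : Z (r v)
      · obtain ⟨a1, a2, a3⟩ := hgZ u h1 hu
        obtain ⟨b1, b2, b3⟩ := hgZ v h2 hv
        have hdx := hd (r u)
        have hdy := hd (r v)
        by_cases hrr : r u = r v
        · have hD : G.dist u v = 2 * d (r u) := by
            rw [← hrr] at b1
            rcases a1 with a1 | a1 <;> rcases b1 with b1 | b1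
            · exact absurd (a1.trans b1.symm) huv
            · rw [← hpq _ (hr u), ← a1, ← b1]
            · rw [← hpq _ (hr u), ← a1, ← b1, SimpleGraph.dist_comm]
            · exact absurd (a1.trans b1.symm) huv
          omega
        · have := heq u v hrr
          omega
      · rw [hgn v h2] at hv
        exact (hmix u v h1 h2 hu hv).1
    · rw [hgn u h1] at hu ⊢
      by_cases h2 : Z (r v)
      · rw [SimpleGraph.dist_comm]
        exact (hmix v u h2 h1 hv hu).2
      · rw [hgn v h2] at hv
        exact hfi' u v huv hu hv
  refine ⟨g, ⟨?_, ?_⟩, ?_, ?_⟩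
  · intro x
    by_cases hx : Z (r x)
    · by_cases hgx : 0 < g x
      · obtain ⟨a1, a2, a3⟩ := hgZ x hx hgx
        have h1 := hpq _ (hr x)
        rcases a1 with a1 | a1
        · rw [← a1] at h1
          have := hecc x (q (r x))
          omega
        · rw [← a1, SimpleGraph.dist_comm] at h1
          have := hecc x (p (r x))
          omega
      · omega
    · rw [hgn x hx]; exact hfb x
  · intro u v huv hu hv
    have h1 := hgind u v huv hu hv
    have h2 := hgind v u huv.symm hv hu
    rw [SimpleGraph.dist_comm] at h2
    exact max_lt h1 h2
  · have hfib : ∀ φ : V → ℕ, bcost φ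
        = ∑ i ∈ Finset.range (k + 1), ∑ x ∈ Finset.univ.filter (fun x => r x = i), φ x := by
      intro φ
      unfold bcost
      rw [Finset.sum_fiberwise_of_maps_to]
      intro x _
      have := hr x
      simp only [Finset.mem_range]; omega
    rw [hfib f, hfib g]
    let C : ℕ → ℕ → Prop := fun i i' => ∃ u, r u = i ∧ T u ∧ i' ≠ i ∧
      (i' - i) + (i - i') + δ u + d i' ≤ f u
    have hpt : ∀ i ∈ Finset.range (k + 1),
        ∑ x ∈ Finset.univ.filter (fun x => r x = i), f x
          + (if E i then 2 * (2 * d i - 1) else 0)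
        ≤ ∑ x ∈ Finset.univ.filter (fun x => r x = i), g x
          + ∑ i' ∈ (Finset.range (k + 1)).filter (fun i' => C i i'), (2 * d i' - 1) := by
      intro i hi
      have hi' : i ≤ k := by simp only [Finset.mem_range] at hi; omega
      by_cases hZ : Z i
      · have hG : 2 * (2 * d i - 1) ≤ ∑ x ∈ Finset.univ.filter (fun x => r x = i), g x := by
          have hsub : ({p i, q i} : Finset V) ⊆ Finset.univ.filter (fun x => r x = i) := by
            intro x hx
            simp only [Finset.mem_insert, Finset.mem_singleton] at hx
            simp only [Finset.mem_filter, Finset.mem_univ, true_and]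
            rcases hx with rfl | rfl
            · exact (hp i hi').1
            · exact (hq i hi').1
          have h1 := Finset.sum_le_sum_of_subset (f := g) hsub
          rw [Finset.sum_pair (hpq' i hi'), hgp i hi' hZ, hgq i hi' hZ] at h1
          omega
        rcases hZ with ⟨u, hu, hTu⟩ | hE
        · have hnE : ¬ E i := fun h => by
            have := hTpos u hTu
            have := h u hu
            omega
          rw [if_neg hnE]
          have hF : ∑ x ∈ Finset.univ.filter (fun x => r x = i), f x = f u := by
            apply Finset.sum_eq_single_of_mem
            · simp [hu]
            · intro x hx hxu
              simp only [Finset.mem_filter, Finset.mem_univ, true_and] at hx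
              exact hTuniq u x hTu (hx.trans hu.symm) hxu
          rw [hF]
          obtain ⟨y, _, hy⟩ := Finset.exists_mem_eq_sup Finset.univ ⟨u, Finset.mem_univ u⟩
            (fun w => G.dist u w)
          have hfu : f u ≤ G.dist u y := by
            have := hfb u
            unfold ecc at this
            rw [hy] at this
            exact this
          have h1 := hub u y
          have h2 := hδ y
          have hc := lob_count k i (f u) (δ u) d hd h0 hk hi' (hu ▸ hδ u) (r y) (hr y)
            (by rw [hu] at h1; omega) (by
              have := hTu.2
              rw [hu] at this
              rintro ⟨a, b, c, e, g⟩
              exact this ⟨a, b, c, e, g⟩)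
          have hle : ∑ i' ∈ (Finset.range (k + 1)).filter
              (fun i' => i' ≠ i ∧ (i' - i) + (i - i') + δ u + d i' ≤ f u), (2 * d i' - 1)
              ≤ ∑ i' ∈ (Finset.range (k + 1)).filter (fun i' => C i i'), (2 * d i' - 1) := by
            apply Finset.sum_le_sum_of_subset
            intro i' hi'
            simp only [Finset.mem_filter] at hi' ⊢
            exact ⟨hi'.1, u, hu, hTu, hi'.2.1, hi'.2.2⟩
          omega
        · rw [if_pos hE]
          have hF : ∑ x ∈ Finset.univ.filter (fun x => r x = i), f x = 0 := by
            apply Finset.sum_eq_zero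
            intro x hx
            simp only [Finset.mem_filter, Finset.mem_univ, true_and] at hx
            exact hE x hx
          omega
      · have hnE : ¬ E i := fun h => hZ (Or.inr h)
        rw [if_neg hnE]
        have hF : ∑ x ∈ Finset.univ.filter (fun x => r x = i), g x
            = ∑ x ∈ Finset.univ.filter (fun x => r x = i), f x := by
          apply Finset.sum_congr rfl
          intro x hx
          simp only [Finset.mem_filter, Finset.mem_univ, true_and] at hx
          exact hgn x (hx ▸ hZ)
        omega
    have hsum := Finset.sum_le_sum hpt
    rw [Finset.sum_add_distrib, Finset.sum_add_distrib] at hsum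
    have hCE : ∀ i i', C i i' → E i' := by
      rintro i i' ⟨u, hu, hTu, hne, hle⟩ x hx
      have h1 := hub u x
      have h2 := hδ x
      rw [hu, hx] at h1
      rw [hx] at h2
      refine hdom u x (hTpos u hTu) (by omega) ?_
      rintro rfl
      exact hne (hx.symm.trans hu)
    have hCC : ∀ a b i', C a i' → C b i' → a < b → ¬ (b < i' ∨ i' < a) := by
      rintro a b i' ⟨u, hu, hTu, hne, hle⟩ ⟨u', hu', hTu', hne', hle'⟩ hab hside
      have hne2 : r u ≠ r u' := by omega
      have h1 := heq u u' hne2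
      have h2 : u ≠ u' := fun h => hne2 (by rw [h])
      have h3 := hfi' u u' h2 (hTpos u hTu) (hTpos u' hTu')
      have h4 := hfi' u' u h2.symm (hTpos u' hTu') (hTpos u hTu)
      rw [SimpleGraph.dist_comm] at h4
      have h5 := hδ u
      have h6 := hδ u'
      have h7 := hd (r u)
      have h8 := hd (r u')
      have h9 := hd i'
      rw [hu, hu'] at h1
      omega
    have hdbl : ∑ i ∈ Finset.range (k + 1),
        ∑ i' ∈ (Finset.range (k + 1)).filter (fun i' => C i i'), (2 * d i' - 1)
        ≤ ∑ i' ∈ Finset.range (k + 1), (if E i' then 2 * (2 * d i' - 1) else 0) := by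
      simp only [Finset.sum_filter]
      rw [Finset.sum_comm]
      apply Finset.sum_le_sum
      intro i' _
      rw [← Finset.sum_filter, Finset.sum_const, smul_eq_mul]
      by_cases hE : E i'
      · rw [if_pos hE]
        apply Nat.mul_le_mul_right
        by_contra hcard
        push Not at hcard
        obtain ⟨a, ha, b, hb, c, hc, hab, hac, hbc⟩ := Finset.two_lt_card.1 hcard
        simp only [Finset.mem_filter] at ha hb hc
        have na : i' ≠ a := by obtain ⟨u, _, _, h, _⟩ := ha.2; exact h
        have nb : i' ≠ b := by obtain ⟨u, _, _, h, _⟩ := hb.2; exact h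
        have nc : i' ≠ c := by obtain ⟨u, _, _, h, _⟩ := hc.2; exact h
        have key : ∀ x y z, C x i' → C y i' → C z i' → i' ≠ y → x < y → y < z → False := by
          intro x y z hx hy hz hne hxy hyz
          have e1 := hCC x y i' hx hy hxy
          have e2 := hCC y z i' hy hz hyz
          clear * - e1 e2 hne hxy hyz
          omega
        rcases lt_or_gt_of_ne hab with h1 | h1 <;> rcases lt_or_gt_of_ne hac with h2 | h2 <;>
          rcases lt_or_gt_of_ne hbc with h3 | h3
        · exact key a b c ha.2 hb.2 hc.2 nb h1 h3
        · exact key a c b ha.2 hc.2 hb.2 nc h2 h3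
        · exact absurd (h1.trans h3) (not_lt.2 h2.le)
        · exact key c a b hc.2 ha.2 hb.2 na h2 h1
        · exact key b a c hb.2 ha.2 hc.2 na h1 h2
        · exact absurd (h1.trans h2) (not_lt.2 h3.le)
        · exact key b c a hb.2 hc.2 ha.2 nc h3 h2
        · exact key c b a hc.2 hb.2 ha.2 nb h3 h1
      · rw [if_neg hE]
        have : (Finset.range (k + 1)).filter (fun i => C i i') = ∅ := by
          apply Finset.filter_eq_empty_iff.2
          intro i _ hC
          exact hE (hCE i i' hC)
        rw [this]; simp
    omega
  · intro i hi
    by_cases hZ : Z i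
    · refine ⟨p i, (hp i hi).1, ?_⟩
      rw [hgp i hi hZ]
      have := hd i
      omega
    · have : ¬ E i := fun h => hZ (Or.inr h)
      simp only [E] at this
      push Not at this
      obtain ⟨x, hx, hfx⟩ := this
      refine ⟨x, hx, ?_⟩
      rw [hgn x (hx ▸ hZ)]
      omega

lemma lob_other {W : Type*} {S : Set W} {a : W} (ha : a ∈ S) (hS : S.ncard ≠ 1) :
    ∃ b ∈ S, b ≠ a := by
  by_contra hcon
  push Not at hcon
  apply hS
  have : S = {a} := by
    ext b
    constructor
    · intro hb; exact hcon b hb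
    · rintro rfl; exact ha
  rw [this, Set.ncard_singleton]

lemma lob_closed {W : Type*} {H : SimpleGraph W} (hH : H.Connected) (S : Set W)
    (hS : ∀ x y, x ∈ S → H.Adj x y → y ∈ S) {x : W} (hx : x ∈ S) (y : W) : y ∈ S := by
  obtain ⟨w⟩ := hH.preconnected x y
  induction w with
  | nil => exact hx
  | cons h _ ih => exact ih (hS _ _ hx h)

lemma lob_leaf_unique {W : Type*} {H : SimpleGraph W} {x : W} (hx : H.IsLeafVert x) :
    ∃ y, H.Adj x y ∧ ∀ z, H.Adj x z → z = y := by
  obtain ⟨y, hy⟩ := Set.ncard_eq_one.1 hx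
  refine ⟨y, ?_, ?_⟩
  · have : y ∈ H.neighborSet x := by rw [hy]; rfl
    exact this
  · intro z hz
    have : z ∈ H.neighborSet x := hz
    rw [hy] at this
    exact this

lemma lob_parent (G : SimpleGraph V) (hL : IsLobster G) (v0 : V) (hv0 : v0 ∈ spineSet G)
    (x : V) (hx : x ∉ spineSet G) :
    ∃ y, G.Adj x y ∧ ¬ G.IsLeafVert y ∧
      (∀ z, G.Adj x z → z = y ∨ (G.IsLeafVert z ∧ ¬ G.IsLeafVert x)) ∧
      (¬ G.IsLeafVert x → y ∈ spineSet G) := by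
  obtain ⟨hT, hC, -⟩ := hL
  obtain ⟨hv, hv'⟩ := hv0
  by_cases hleaf : G.IsLeafVert x
  · obtain ⟨y, hxy, hy⟩ := lob_leaf_unique hleaf
    refine ⟨y, hxy, ?_, fun z hz => Or.inl (hy z hz), fun h => absurd hleaf h⟩
    intro hyl
    obtain ⟨x', _, hx'⟩ := lob_leaf_unique hyl
    have hxx := hx' x hxy.symm
    subst hxx
    have := lob_closed hT.connected {x, y} (by
      rintro a b (rfl | rfl) hab
      · right; exact hy b hab
      · left; exact hx' b hab) (Or.inl rfl) v0
    rcases this with h | h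
    · exact hv (h ▸ hleaf)
    · exact hv ((Set.mem_singleton_iff.1 h) ▸ hyl)
  · have hpl : (pruned G).IsLeafVert ⟨x, hleaf⟩ := by
      by_contra h
      exact hx ⟨hleaf, h⟩
    obtain ⟨⟨y, hyn⟩, hxy, hy⟩ := lob_leaf_unique hpl
    have hxyG : G.Adj x y := hxy
    refine ⟨y, hxyG, hyn, ?_, ?_⟩
    · intro z hz
      by_cases hzl : G.IsLeafVert z
      · exact Or.inr ⟨hzl, hleaf⟩
      · left
        have := hy ⟨z, hzl⟩ hz
        exact congrArg Subtype.val this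
    · intro _
      refine ⟨hyn, ?_⟩
      intro hyl
      obtain ⟨x', _, hx'⟩ := lob_leaf_unique hyl
      have hxx := hx' ⟨x, hleaf⟩ hxy.symm
      subst hxx
      have := lob_closed hC.connected {⟨x, hleaf⟩, ⟨y, hyn⟩} (by
        rintro a b (rfl | rfl) hab
        · right; exact hy b hab
        · left; exact hx' b hab) (Or.inl rfl) ⟨v0, hv⟩
      rcases this with h | h
      · exact hv' (h ▸ hpl)
      · exact hv' ((Set.mem_singleton_iff.1 h) ▸ hyl)

lemma lob_struct (G : SimpleGraph V) (k : ℕ) (hL : IsLobster G) (s : SpineEnum G k) :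
    ∃ (par : V → V) (r δ : V → ℕ),
      (∀ i ≤ k, r (s.v i) = i ∧ δ (s.v i) = 0) ∧
      (∀ x, r x ≤ k ∧ δ x ≤ 2) ∧
      (∀ x, δ x = 0 → x = s.v (r x)) ∧
      (∀ x, 0 < δ x → G.Adj x (par x) ∧ r (par x) = r x ∧ δ x = δ (par x) + 1) ∧
      (∀ x y, G.Adj x y → (δ x = 0 ∧ δ y = 0) ∨ (0 < δ x ∧ par x = y) ∨
        (0 < δ y ∧ par y = x)) ∧
      (∀ x, δ x = 2 → G.IsLeafVert x) ∧ (∀ x, δ x = 0 ↔ x ∈ spineSet G) := by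
  have hv0 : s.v 0 ∈ spineSet G := (s.mem _).2 ⟨0, Nat.zero_le _, rfl⟩
  have hpar : ∀ x, ∃ y, x ∉ spineSet G → G.Adj x y ∧ ¬ G.IsLeafVert y ∧
      (∀ z, G.Adj x z → z = y ∨ (G.IsLeafVert z ∧ ¬ G.IsLeafVert x)) ∧
      (¬ G.IsLeafVert x → y ∈ spineSet G) := by
    intro x
    by_cases hx : x ∈ spineSet G
    · exact ⟨x, fun h => absurd hx h⟩
    · obtain ⟨y, hy⟩ := lob_parent G hL _ hv0 x hx
      exact ⟨y, fun _ => hy⟩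
  choose par hpar using hpar
  have hidx : ∀ x, ∃ i, i ≤ k ∧ (x ∈ spineSet G → s.v i = x) := by
    intro x
    by_cases hx : x ∈ spineSet G
    · obtain ⟨i, hi, h⟩ := (s.mem x).1 hx
      exact ⟨i, hi, fun _ => h⟩
    · exact ⟨0, Nat.zero_le _, fun h => absurd h hx⟩
  choose idx hidxk hidx using hidx
  let root : V → V := fun x => if x ∈ spineSet G then x else
    if par x ∈ spineSet G then par x else par (par x)
  let δ : V → ℕ := fun x => if x ∈ spineSet G then 0 else if par x ∈ spineSet G then 1 else 2
  have hδ0 : ∀ x, δ x = 0 ↔ x ∈ spineSet G := by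
    intro x
    simp only [δ]
    split_ifs <;> simp_all
  have hroot0 : ∀ x, x ∈ spineSet G → root x = x := fun x hx => by simp [root, hx]
  refine ⟨par, fun x => idx (root x), δ, ?_, ?_, ?_, ?_, ?_, ?_, hδ0⟩
  · intro i hi
    have hm : s.v i ∈ spineSet G := (s.mem _).2 ⟨i, hi, rfl⟩
    refine ⟨?_, (hδ0 _).2 hm⟩
    simp only [hroot0 _ hm]
    exact s.inj _ (hidxk _) _ hi (hidx _ hm)
  · intro x
    refine ⟨hidxk _, ?_⟩
    simp only [δ]
    split_ifs <;> omega
  · intro x hx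
    have hm := (hδ0 x).1 hx
    simp only [hroot0 x hm]
    exact (hidx x hm).symm
  · intro x hx
    have hm : x ∉ spineSet G := fun h => by
      have := (hδ0 x).2 h
      omega
    obtain ⟨h1, h2, h3, h4⟩ := hpar x hm
    refine ⟨h1, ?_⟩
    by_cases hp : par x ∈ spineSet G
    · simp [root, δ, hm, hp]
    · have hpp := (hpar (par x) hp).2.2.2 h2
      simp [root, δ, hm, hp, hpp]
  · intro x y hxy
    have hpos : ∀ x, x ∉ spineSet G → 0 < δ x := fun x hx =>
      Nat.pos_of_ne_zero (fun h => hx ((hδ0 x).1 h))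
    by_cases hx : x ∈ spineSet G
    · by_cases hy : y ∈ spineSet G
      · exact Or.inl ⟨(hδ0 x).2 hx, (hδ0 y).2 hy⟩
      · right; right
        refine ⟨hpos y hy, ?_⟩
        rcases (hpar y hy).2.2.1 x hxy.symm with h | h
        · exact h.symm
        · exact absurd h.1 hx.1
    · rcases (hpar x hx).2.2.1 y hxy with h | ⟨h, hxl⟩
      · exact Or.inr (Or.inl ⟨hpos x hx, h.symm⟩)
      · have hy : y ∉ spineSet G := fun hy => hy.1 h
        right; right
        refine ⟨hpos y hy, ?_⟩
        rcases (hpar y hy).2.2.1 x hxy.symm with h' | h'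
        · exact h'.symm
        · exact absurd h'.1 hxl
  · intro x hx
    by_contra hl
    by_cases hm : x ∈ spineSet G
    · have := (hδ0 x).2 hm; omega
    · have := (hpar x hm).2.2.2 hl
      simp [δ, hm, this] at hx

lemma lob_upper (G : SimpleGraph V) (k : ℕ) (hc : G.Connected) (v : ℕ → V)
    (hv : ∀ i, i + 1 ≤ k → G.Adj (v i) (v (i + 1)))
    (par : V → V) (r δ : V → ℕ)
    (hb : ∀ x, r x ≤ k ∧ δ x ≤ 2) (h0 : ∀ x, δ x = 0 → x = v (r x))
    (hp : ∀ x, 0 < δ x → G.Adj x (par x) ∧ r (par x) = r x ∧ δ x = δ (par x) + 1) (x y : V) :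
    G.dist x y ≤ (r x - r y) + (r y - r x) + δ x + δ y := by
  have hroot : ∀ n x, δ x = n → G.dist x (v (r x)) ≤ n := by
    intro n
    induction n with
    | zero =>
      intro x hx
      rw [← h0 x hx, SimpleGraph.dist_self]
    | succ n ih =>
      intro x hx
      obtain ⟨h1, h2, h3⟩ := hp x (by omega)
      have h4 := ih (par x) (by omega)
      rw [h2] at h4
      have h5 := hc.dist_triangle (u := x) (v := par x) (w := v (r x))
      rw [SimpleGraph.dist_eq_one_iff_adj.2 h1] at h5
      omega
  have hsp : ∀ n i, i + n ≤ k → G.dist (v i) (v (i + n)) ≤ n := by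
    intro n
    induction n with
    | zero => intro i _; simp
    | succ n ih =>
      intro i hi
      have h4 := ih i (by omega)
      have h5 := hc.dist_triangle (u := v i) (v := v (i + n)) (w := v (i + (n + 1)))
      have h6 : G.dist (v (i + n)) (v (i + (n + 1))) = 1 :=
        SimpleGraph.dist_eq_one_iff_adj.2 (hv (i + n) (by omega))
      omega
  have hspine : G.dist (v (r x)) (v (r y)) ≤ (r x - r y) + (r y - r x) := by
    rcases Nat.le_total (r x) (r y) with h | h
    · have := hsp (r y - r x) (r x) (by have := (hb y).1; omega)
      rw [Nat.add_sub_cancel' h] at this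
      omega
    · have := hsp (r x - r y) (r y) (by have := (hb x).1; omega)
      rw [Nat.add_sub_cancel' h, SimpleGraph.dist_comm] at this
      omega
  have t1 := hc.dist_triangle (u := x) (v := v (r x)) (w := y)
  have t2 := hc.dist_triangle (u := v (r x)) (v := v (r y)) (w := y)
  have t3 := hroot _ x rfl
  have t4 := hroot _ y rfl
  rw [SimpleGraph.dist_comm] at t4
  omega

lemma lob_lower (G : SimpleGraph V) (hc : G.Connected) (v : ℕ → V)
    (par : V → V) (r δ : V → ℕ) (hδ2 : ∀ x, δ x ≤ 2)
    (h0 : ∀ x, δ x = 0 → x = v (r x))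
    (hp : ∀ x, 0 < δ x → G.Adj x (par x) ∧ r (par x) = r x ∧ δ x = δ (par x) + 1)
    (hedge : ∀ x y, G.Adj x y → (δ x = 0 ∧ δ y = 0 ∧ (r x + 1 = r y ∨ r y + 1 = r x)) ∨
      (0 < δ x ∧ par x = y) ∨ (0 < δ y ∧ par y = x))
    (b : V → V) (hb : ∀ x, b x = if δ x = 2 then par x else x) (x y : V) (hxy : b x ≠ b y) :
    (r x - r y) + (r y - r x) + δ x + δ y ≤ G.dist x y := by
  have hb2 : ∀ z, δ z = 2 → b z = par z := fun z hz => by rw [hb, if_pos hz]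
  have hb1 : ∀ z, δ z ≠ 2 → b z = z := fun z hz => by rw [hb, if_neg hz]
  have hbr : ∀ z, r (b z) = r z := by
    intro z
    by_cases hz : δ z = 2
    · rw [hb2 z hz]; exact (hp z (by omega)).2.1
    · rw [hb1 z hz]
  have hbδ : ∀ z, δ (b z) = min (δ z) 1 := by
    intro z
    have := hδ2 z
    by_cases hz : δ z = 2
    · rw [hb2 z hz]
      have := (hp z (by omega)).2.2
      omega
    · rw [hb1 z hz]; omega
  let F : V → ℕ := fun z => (r x - r z) + (r z - r x) + δ x + δ z
  let φ : V → ℕ := fun z => if z = x then 0 else if b z = b x then 1 else F z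
  have φF : ∀ z, b z ≠ b x → φ z = F z := by
    intro z hz
    have : z ≠ x := fun h => hz (by rw [h])
    simp only [φ, if_neg this, if_neg hz]
  have φs : ∀ z, δ z = 0 → φ z = F z := by
    intro z hz
    by_cases h : b z = b x
    · have h1 := hbδ z
      have h2 := hbδ x
      rw [h] at h1
      have h3 : δ x = 0 := by omega
      have h4 : z = x := by
        rw [hb1 z (by omega), hb1 x (by omega)] at h; exact h
      subst h4
      simp [φ, F, hz]
    · exact φF z h
  have φle : ∀ z, b z = b x → φ z ≤ 1 := by
    intro z hz
    simp only [φ, if_pos hz]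
    split_ifs <;> omega
  have hup : ∀ z, 0 < δ z → φ (par z) ≤ φ z + 1 ∧ φ z ≤ φ (par z) + 1 := by
    intro z hz
    obtain ⟨-, h2, h3⟩ := hp z hz
    by_cases hz2 : δ z = 2
    · have hbb : b (par z) = b z := by rw [hb2 z hz2, hb1 _ (by omega)]
      by_cases h : b z = b x
      · have := φle z h
        have := φle (par z) (hbb.trans h)
        omega
      · rw [φF z h, φF (par z) (hbb ▸ h)]
        simp only [F, h2]
        omega
    · have hz1 : δ z = 1 := by have := hδ2 z; omega
      have hbz := hb1 z hz2
      rw [φs (par z) (by omega)]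
      by_cases h : b z = b x
      · have hrx : r x = r z := by rw [← hbr x, ← h, hbr z]
        have hF : F (par z) = δ x := by
          simp only [F, h2, hrx]; omega
        rw [hF]
        have h4 := hbδ x
        rw [← h, hbz] at h4
        by_cases hzx : z = x
        · subst hzx
          have : φ z = 0 := by simp [φ]
          omega
        · have : φ z = 1 := by simp [φ, hzx, h]
          have := hδ2 x
          omega
      · rw [φF z h]
        simp only [F, h2]
        omega
  have hLip : ∀ y z, G.Adj y z → φ z ≤ φ y + 1 := by
    intro y z hyz
    rcases hedge y z hyz with ⟨h1, h2, h3⟩ | ⟨h1, rfl⟩ | ⟨h1, rfl⟩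
    · rw [φs y h1, φs z h2]
      simp only [F]
      omega
    · exact (hup y h1).1
    · exact (hup z h1).2
  have hwalk : ∀ (a c : V) (w : G.Walk a c), φ c ≤ φ a + w.length := by
    intro a c w
    induction w with
    | nil => simp
    | cons h _ ih =>
      have := hLip _ _ h
      rw [SimpleGraph.Walk.length_cons]
      omega
  obtain ⟨w, hw⟩ := hc.exists_walk_length_eq_dist x y
  have h1 := hwalk x y w
  have h2 : φ x = 0 := by simp [φ]
  have h3 := φF y (Ne.symm hxy)
  simp only [F] at h3
  omega

/-- if `L` is a locally uniform 2-lobster of length `k ≥ 1` and `f`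
is an optimal independent broadcast on `L`, then there exists an optimal
independent broadcast `g` on `L` with `g*(S_i) > 0` for every `0 ≤ i ≤ k`. -/
theorem stmt15 {V : Type*} [Fintype V] (G : SimpleGraph V) (k : ℕ) (hk : 1 ≤ k)
    (hL : IsLobster G) (s : SpineEnum G k) (hlu : LocallyUniform G s)
    (h2 : IsTwoLobster G s)
    (f : V → ℕ) (hf : IsIndepBroadcast G f) (hopt : bcost f = betaB G) :
    ∃ g : V → ℕ, IsIndepBroadcast G g ∧ bcost g = betaB G ∧
      ∀ i ≤ k, 0 < fstar G g (s.v i) := by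
  have hc : G.Connected := hL.1.connected
  obtain ⟨par, r, δ, hv, hb, h0, hp, hedge, hleaf2, hsp⟩ := lob_struct G k hL s
  have hedge' : ∀ x y, G.Adj x y → (δ x = 0 ∧ δ y = 0 ∧ (r x + 1 = r y ∨ r y + 1 = r x)) ∨
      (0 < δ x ∧ par x = y) ∨ (0 < δ y ∧ par y = x) := by
    intro x y hxy
    rcases hedge x y hxy with ⟨h1, h3⟩ | h
    · left
      refine ⟨h1, h3, ?_⟩
      rw [h0 x h1, h0 y h3] at hxy
      exact (s.adj _ (hb x).1 _ (hb y).1).1 hxy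
    · exact Or.inr h
  let b : V → V := fun x => if δ x = 2 then par x else x
  have hub := lob_upper G k hc s.v
    (fun i hi => (s.adj i (by omega) (i + 1) hi).2 (Or.inl rfl)) par r δ hb h0 hp
  have hlb := lob_lower G hc s.v par r δ (fun x => (hb x).2) h0 hp hedge' b (fun _ => rfl)
  have hbr : ∀ z, r (b z) = r z := by
    intro z
    by_cases hz : δ z = 2
    · simp only [b, if_pos hz]; exact (hp z (by omega)).2.1
    · simp only [b, if_neg hz]
  have heq : ∀ x y, b x ≠ b y → G.dist x y = (r x - r y) + (r y - r x) + δ x + δ y :=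
    fun x y h => le_antisymm (hub x y) (hlb x y h)
  have heq' : ∀ x y, r x ≠ r y → G.dist x y = (r x - r y) + (r y - r x) + δ x + δ y :=
    fun x y h => heq x y (fun h' => h (by rw [← hbr x, ← hbr y, h']))
  have hdroot : ∀ x, G.dist (s.v (r x)) x = δ x := by
    intro x
    obtain ⟨e1, e2⟩ := hv (r x) (hb x).1
    by_cases hx : δ x = 0
    · rw [← h0 x hx, SimpleGraph.dist_self, hx]
    · rw [heq, e1, e2]
      · omega
      · intro h
        have : b (s.v (r x)) = s.v (r x) := by simp [b, e2]
        rw [this] at h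
        by_cases hz : δ x = 2
        · simp only [b, if_pos hz] at h
          have := (hp x (by omega)).2.2
          rw [← h] at this
          omega
        · simp only [b, if_neg hz] at h
          rw [← h] at hx
          exact hx e2
  have hmem : ∀ n x, δ x = n → x ∈ Ssub G (s.v (r x)) := by
    intro n
    induction n with
    | zero =>
      intro x hx
      rw [← h0 x hx]
      exact SimpleGraph.Reachable.refl _
    | succ n ih =>
      intro x hx
      obtain ⟨e1, e2, e3⟩ := hp x (by omega)
      have e4 := ih (par x) (by omega)
      rw [e2] at e4
      have hadj : (offSpine G).Adj (par x) x := by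
        unfold offSpine
        rw [SimpleGraph.deleteEdges_adj]
        refine ⟨e1.symm, ?_⟩
        intro hall
        have := (hsp x).2 (hall x (Sym2.mem_mk_right _ _))
        omega
      exact SimpleGraph.Reachable.trans e4 hadj.reachable
  have hchild : ∀ y, δ y = 1 → ¬ G.IsLeafVert y → ∃ z, par z = y ∧ δ z = 2 ∧ r z = r y := by
    intro y hy hl
    obtain ⟨e1, e2, e3⟩ := hp y (by omega)
    obtain ⟨z, hz, hne⟩ := lob_other (S := G.neighborSet y) (a := par y) e1 hl
    rcases hedge y z hz with ⟨a1, a2⟩ | ⟨a1, a2⟩ | ⟨a1, a2⟩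
    · omega
    · exact absurd a2.symm hne
    · obtain ⟨c1, c2, c3⟩ := hp z a1
      rw [a2] at c2 c3
      exact ⟨z, a2, by omega, c2.symm⟩
  let d : ℕ → ℕ := fun i => if i ≤ k ∧ typeS1 G (s.v i) then 1 else 2
  have hd : ∀ i, d i = 1 ∨ d i = 2 := by
    intro i
    simp only [d]
    split_ifs
    · exact Or.inl rfl
    · exact Or.inr rfl
  have hδd : ∀ x, δ x ≤ d (r x) := by
    intro x
    have := (hb x).2
    simp only [d]
    split_ifs with h
    · by_contra hcon
      have hx2 : δ x = 2 := by omega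
      have h3 := h.2 x (hmem _ x rfl) (hleaf2 x hx2)
      rw [hdroot] at h3
      omega
    · exact this
  have hend : ∀ i i', i ≤ k → i' ≤ k → (∀ j ≤ k, G.Adj (s.v i) (s.v j) ↔ j = i') → d i = 2 := by
    intro i i' hi hi' hadj
    have hm : s.v i ∈ spineSet G := (s.mem _).2 ⟨i, hi, rfl⟩
    have hm' : s.v i' ∈ spineSet G := (s.mem _).2 ⟨i', hi', rfl⟩
    obtain ⟨hn, hpn⟩ := hm
    have ha : (⟨s.v i', hm'.1⟩ : nonleaves G) ∈ (pruned G).neighborSet ⟨s.v i, hn⟩ :=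
      (hadj i' hi').2 rfl
    obtain ⟨⟨z, hzn⟩, hz, hne⟩ := lob_other ha hpn
    have hzadj : G.Adj (s.v i) z := hz
    have hzs : z ∉ spineSet G := by
      intro hzs
      obtain ⟨j, hj, rfl⟩ := (s.mem z).1 hzs
      have := (hadj j hj).1 hzadj
      subst this
      exact hne rfl
    have hzδ : δ z ≠ 0 := fun h => hzs ((hsp z).1 h)
    obtain ⟨e1, e2⟩ := hv i hi
    have hz1 : par z = s.v i := by
      rcases hedge _ _ hzadj with ⟨a1, a2⟩ | ⟨a1, a2⟩ | ⟨a1, a2⟩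
      · exact absurd a2 hzδ
      · omega
      · exact a2
    obtain ⟨-, c2, c3⟩ := hp z (by omega)
    rw [hz1] at c2 c3
    obtain ⟨t, -, ht2, ht3⟩ := hchild z (by omega) hzn
    have h5 := hδd t
    have h6 : r t = i := by omega
    rw [h6] at h5
    have := hd i
    omega
  have hd0 : d 0 = 2 := hend 0 1 (by omega) hk (fun j hj => by
    rw [s.adj 0 (by omega) j hj]; omega)
  have hdk : d k = 2 := hend k (k - 1) le_rfl (by omega) (fun j hj => by
    rw [s.adj k le_rfl j hj]; omega)
  have hext : ∀ i ≤ k, ∀ y, δ y = 1 → r y = i → ∃ z, b z = y ∧ r z = i ∧ δ z = d i := by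
    intro i hi y hy hri
    by_cases h : typeS1 G (s.v i)
    · have hdi : d i = 1 := by simp [d, hi, h]
      exact ⟨y, by simp [b, hy], hri, by omega⟩
    · have hdi : d i = 2 := by simp [d, h]
      have hS2 : typeS2 G (s.v i) := (hlu i hi).resolve_left h
      have hnl : ¬ G.IsLeafVert y := by
        intro hl
        subst hri
        have := hS2 y (hmem _ y rfl) hl
        rw [hdroot] at this
        omega
      obtain ⟨z, hz1, hz2, hz3⟩ := hchild y hy hnl
      exact ⟨z, by simp [b, hz2, hz1], hz3.trans hri, by omega⟩
  have hPQ : ∀ i, ∃ p q : V, i ≤ k → (r p = i ∧ δ p = d i) ∧ (r q = i ∧ δ q = d i) ∧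
      G.dist p q = 2 * d i := by
    intro i
    by_cases hi : i ≤ k
    · have hcard := h2 i hi
      obtain ⟨y1, hy1, y2, hy2, hne⟩ := (Set.one_lt_ncard_iff_nontrivial (s := branchRoots G (s.v i))).1
        (by omega)
      have hbr1 : ∀ y ∈ branchRoots G (s.v i), δ y = 1 ∧ r y = i := by
        intro y hy
        have hy' : (offSpine G).Adj (s.v i) y := hy
        unfold offSpine at hy'
        rw [SimpleGraph.deleteEdges_adj] at hy'
        obtain ⟨hadj, hnot⟩ := hy'
        obtain ⟨e1, e2⟩ := hv i hi
        have hys : δ y ≠ 0 := by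
          intro h
          apply hnot
          intro x hx
          rcases Sym2.mem_iff.1 hx with rfl | rfl
          · exact (hsp _).1 e2
          · exact (hsp _).1 h
        rcases hedge _ _ hadj with ⟨a1, a2⟩ | ⟨a1, a2⟩ | ⟨a1, a2⟩
        · exact absurd a2 hys
        · omega
        · obtain ⟨-, c2, c3⟩ := hp y a1
          rw [a2] at c2 c3
          omega
      obtain ⟨p, p1, p2, p3⟩ := hext i hi y1 (hbr1 y1 hy1).1 (hbr1 y1 hy1).2
      obtain ⟨q, q1, q2, q3⟩ := hext i hi y2 (hbr1 y2 hy2).1 (hbr1 y2 hy2).2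
      refine ⟨p, q, fun _ => ⟨⟨p2, p3⟩, ⟨q2, q3⟩, ?_⟩⟩
      rw [heq p q (by rw [p1, q1]; exact hne)]
      omega
    · exact ⟨s.v 0, s.v 0, fun h => absurd h hi⟩
  choose p q hPQ using hPQ
  have hbdd : BddAbove {c : ℕ | ∃ f : V → ℕ, IsIndepBroadcast G f ∧ bcost f = c} := by
    refine ⟨∑ v, ecc G v, ?_⟩
    rintro c ⟨g, hg, rfl⟩
    exact Finset.sum_le_sum (fun v _ => hg.1 v)
  have hle : ∀ g : V → ℕ, IsIndepBroadcast G g → bcost g ≤ betaB G := fun g hg =>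
    le_csSup hbdd ⟨g, hg, rfl⟩
  obtain ⟨g, hg1, hg2, hg3⟩ := lob_main G k r δ d hd hd0 hdk (fun x => (hb x).1) hδd hub heq'
    p q (fun i hi => (hPQ i hi).1) (fun i hi => (hPQ i hi).2.1) (fun i hi => (hPQ i hi).2.2)
    f hf (fun g hg => hopt ▸ hle g hg)
  refine ⟨g, hg1, le_antisymm (hle g hg1) (hopt ▸ hg2), ?_⟩
  intro i hi
  obtain ⟨x, hx, hgx⟩ := hg3 i hi
  have hxm : x ∈ Ssub G (s.v i) := hx ▸ hmem _ x rfl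
  unfold fstar
  rw [finsum_mem_eq_sum_of_inter_support_eq (s := Ssub G (s.v i)) g
    (t := Finset.univ.filter (fun y => y ∈ Ssub G (s.v i))) (by ext; simp)]
  exact lt_of_lt_of_le hgx (Finset.single_le_sum (f := g) (fun _ _ => Nat.zero_le _)
    (by simpa using hxm))
end
end

section
/- If L is a locally uniform 2-lobster of length k ≥ 1 and f is an optimal independent broadcast on L, then there exists an optimal independent broadcast f̃ on L such that, for every spine-subtree S_i of L (0 ≤ i ≤ k) and every vertex x of S_i: f̃(x) ≤ 1 if x = v_i, f̃(x) ≤ 3 if x is a 1-leaf of S_i, and f̃(x) ≤ 4 if x is a 2-leaf of S_i. -/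
noncomputable section

open scoped Classical

variable {V : Type*}

/-- Coordinates on a locally uniform 2-lobster: spine position, depth and parent. -/
structure LobData (G : SimpleGraph V) (k : ℕ) where
  v : ℕ → V
  pos : V → ℕ
  dep : V → ℕ
  par : V → V
  hpos : ∀ x, pos x ≤ k
  hdep : ∀ x, dep x ≤ 2
  hv : ∀ i ≤ k, pos (v i) = i ∧ dep (v i) = 0
  hv0 : ∀ x, dep x = 0 → x = v (pos x)
  hadjv : ∀ i < k, G.Adj (v i) (v (i + 1))
  hpar : ∀ x, 0 < dep x → G.Adj x (par x) ∧ pos (par x) = pos x ∧ dep (par x) + 1 = dep x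
  hedge : ∀ a b, G.Adj a b →
    (dep a = 0 ∧ dep b = 0 ∧ (pos a + 1 = pos b ∨ pos b + 1 = pos a)) ∨
    (pos a = pos b ∧ (dep a + 1 = dep b ∨ dep b + 1 = dep a))
  hleaf : ∀ x y, dep x = 2 → G.Adj x y → y = par x
  hunif : ∀ x w, dep x = 2 → dep w = 1 → pos w = pos x → ∃ c, dep c = 2 ∧ par c = w
  hend0 : ∃ x, dep x = 2 ∧ pos x = 0
  hendk : ∃ x, dep x = 2 ∧ pos x = k
  htwo : ∀ i ≤ k, ∃ w₁ w₂, w₁ ≠ w₂ ∧ dep w₁ = 1 ∧ dep w₂ = 1 ∧ pos w₁ = i ∧ pos w₂ = i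

/-- A function that grows by at most one along edges is a lower bound for distances. -/
theorem lip_le_dist {G : SimpleGraph V} (hG : G.Connected) (D : V → ℤ) (x : V)
    (h0 : D x = 0) (hD : ∀ a b, G.Adj a b → D b ≤ D a + 1) (y : V) :
    D y ≤ G.dist x y := by
  have key : ∀ (a b : V) (p : G.Walk a b), D b ≤ D a + p.length := by
    intro a b p
    induction p with
    | nil => simp
    | cons h p ih =>
      have := hD _ _ h
      rw [SimpleGraph.Walk.length_cons]
      push_cast
      linarith
  obtain ⟨p, hp⟩ := hG.exists_walk_length_eq_dist x y
  have := key x y p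
  rw [h0, hp] at this
  linarith

theorem leaf_dist {G : SimpleGraph V} (hG : G.Connected) {x w y : V}
    (hx : ∀ z, G.Adj x z → z = w) (hxy : x ≠ y) : G.dist w y + 1 ≤ G.dist x y := by
  obtain ⟨p, hp⟩ := hG.exists_walk_length_eq_dist x y
  cases p with
  | nil => exact absurd rfl hxy
  | cons h p =>
    have := hx _ h
    subst this
    rw [SimpleGraph.Walk.length_cons] at hp
    have := SimpleGraph.dist_le p
    omega

namespace LobData

variable {G : SimpleGraph V} {k : ℕ} (d : LobData G k)

theorem dist_spine (hG : G.Connected) (i n : ℕ) (h : i + n ≤ k) :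
    G.dist (d.v i) (d.v (i + n)) ≤ n := by
  induction n with
  | zero => simp
  | succ n ih =>
    have h1 := ih (by omega)
    have h2 := hG.dist_triangle (u := d.v i) (v := d.v (i + n)) (w := d.v (i + (n + 1)))
    have h3 : G.dist (d.v (i + n)) (d.v (i + (n + 1))) = 1 :=
      SimpleGraph.dist_eq_one_iff_adj.2 (d.hadjv (i + n) (by omega))
    omega

theorem dist_root (hG : G.Connected) (x : V) : G.dist x (d.v (d.pos x)) ≤ d.dep x := by
  have key : ∀ n x, d.dep x = n → G.dist x (d.v (d.pos x)) ≤ n := by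
    intro n
    induction n with
    | zero =>
      intro x hx
      rw [← d.hv0 x hx]
      simp
    | succ n ih =>
      intro x hx
      obtain ⟨h1, h2, h3⟩ := d.hpar x (by omega)
      have h4 := ih (d.par x) (by omega)
      rw [h2] at h4
      have h5 := hG.dist_triangle (u := x) (v := d.par x) (w := d.v (d.pos x))
      have h6 : G.dist x (d.par x) = 1 := SimpleGraph.dist_eq_one_iff_adj.2 h1
      omega
  exact key _ x rfl

theorem dist_upper (hG : G.Connected) (x y : V) :
    (G.dist x y : ℤ) ≤ d.dep x + d.dep y + |(d.pos x : ℤ) - d.pos y| := by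
  have hx := d.dist_root hG x
  have hy := d.dist_root hG y
  rw [SimpleGraph.dist_comm] at hy
  have hxk := d.hpos x
  have hyk := d.hpos y
  have t1 := hG.dist_triangle (u := x) (v := d.v (d.pos x)) (w := y)
  have t2 := hG.dist_triangle (u := d.v (d.pos x)) (v := d.v (d.pos y)) (w := y)
  have t3 : (G.dist (d.v (d.pos x)) (d.v (d.pos y)) : ℤ) ≤ |(d.pos x : ℤ) - d.pos y| := by
    rcases le_total (d.pos x) (d.pos y) with h | h
    · obtain ⟨n, hn⟩ := Nat.exists_eq_add_of_le h
      have := d.dist_spine hG (d.pos x) n (by omega)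
      rw [← hn] at this
      rw [abs_of_nonpos (by omega)]
      omega
    · obtain ⟨n, hn⟩ := Nat.exists_eq_add_of_le h
      have := d.dist_spine hG (d.pos y) n (by omega)
      rw [← hn, SimpleGraph.dist_comm] at this
      rw [abs_of_nonneg (by omega)]
      omega
  omega

theorem dist_lower (hG : G.Connected) (x y : V) (hne : d.pos x ≠ d.pos y) :
    (d.dep x : ℤ) + d.dep y + |(d.pos x : ℤ) - d.pos y| ≤ G.dist x y := by
  have := lip_le_dist hG (fun u => if d.pos u = d.pos x then (d.dep x : ℤ) - d.dep u
    else (d.dep x : ℤ) + d.dep u + |(d.pos x : ℤ) - d.pos u|) x (by simp) (by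
      intro a b hab
      have h := d.hedge a b hab
      split_ifs <;> rcases h with ⟨h1, h2, h3⟩ | ⟨h1, h2⟩ <;> grind) y
  simp only [if_neg (Ne.symm hne)] at this
  exact this

theorem dist_same_one (hG : G.Connected) (x y : V) (hx : d.dep x = 1) (hy : d.dep y = 1)
    (hne : x ≠ y) : 2 ≤ G.dist x y := by
  have h0 : 0 < G.dist x y := hG.pos_dist_of_ne hne
  have h1 : G.dist x y ≠ 1 := by
    intro h
    have := d.hedge x y (SimpleGraph.dist_eq_one_iff_adj.1 h)
    omega
  omega

theorem dist_same_two (hG : G.Connected) (x y : V) (hx : d.dep x = 2) (hy : d.dep y = 2)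
    (hne : d.par x ≠ d.par y) : 4 ≤ G.dist x y := by
  have hxy : x ≠ y := fun h => hne (by rw [h])
  have hpx := d.hpar x (by omega)
  have hpy := d.hpar y (by omega)
  have h1 := leaf_dist hG (fun z hz => d.hleaf x z hx hz) hxy
  have h2 : y ≠ d.par x := by
    intro h
    rw [← h] at hpx
    omega
  have h3 := leaf_dist hG (fun z hz => d.hleaf y z hy hz) h2
  have h4 := d.dist_same_one hG (d.par y) (d.par x) (by omega) (by omega) hne.symm
  rw [SimpleGraph.dist_comm] at h1
  rw [SimpleGraph.dist_comm] at h3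
  have h5 := SimpleGraph.dist_comm (G := G) (u := d.par x) (v := y)
  have h6 := SimpleGraph.dist_comm (G := G) (u := d.par x) (v := d.par y)
  have h7 := SimpleGraph.dist_comm (G := G) (u := x) (v := y)
  omega

/-- Spine position `i` carries a vertex at depth two. -/
def is2 (i : ℕ) : Prop := ∃ x, d.dep x = 2 ∧ d.pos x = i

/-- A chosen child. -/
def ch (w : V) : V := if h : ∃ c, d.dep c = 2 ∧ d.par c = w then h.choose else w

/-- Standard filling. -/
def fill (z : V) : ℕ :=
  if d.dep z = 1 ∧ ¬ d.is2 (d.pos z) then 1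
  else if d.dep z = 2 ∧ z = d.ch (d.par z) then 3 else 0

theorem fill_cases (z : V) (h : 0 < d.fill z) :
    (d.dep z = 1 ∧ ¬ d.is2 (d.pos z) ∧ d.fill z = 1) ∨
    (d.dep z = 2 ∧ d.is2 (d.pos z) ∧ z = d.ch (d.par z) ∧ d.fill z = 3) := by
  unfold fill at *
  split_ifs at * with h1 h2
  · exact Or.inl ⟨h1.1, h1.2, rfl⟩
  · exact Or.inr ⟨h2.1, ⟨z, h2.1, rfl⟩, h2.2, rfl⟩
  · omega

theorem fill_indep (hG : G.Connected) (z z' : V) (hne : z ≠ z') (h : 0 < d.fill z)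
    (h' : 0 < d.fill z') : max (d.fill z) (d.fill z') < G.dist z z' := by
  by_cases hp : d.pos z = d.pos z'
  · rcases d.fill_cases z h with ⟨h1, h2, h3⟩ | ⟨h1, h2, h3, h4⟩ <;>
      rcases d.fill_cases z' h' with ⟨h1', h2', h3'⟩ | ⟨h1', h2', h3', h4'⟩
    · have := d.dist_same_one hG z z' h1 h1' hne
      omega
    · rw [hp] at h2; exact absurd h2' h2
    · rw [hp] at h2; exact absurd h2 h2'
    · have := d.dist_same_two hG z z' h1 h1' (by
        intro hh
        rw [hh, ← h3'] at h3
        exact hne h3)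
      omega
  · have hd := d.dist_lower hG z z' hp
    have : 1 ≤ |(d.pos z : ℤ) - d.pos z'| := by
      apply Int.one_le_abs
      omega
    rcases d.fill_cases z h with ⟨h1, h2, h3⟩ | ⟨h1, h2, h3, h4⟩ <;>
      rcases d.fill_cases z' h' with ⟨h1', h2', h3'⟩ | ⟨h1', h2', h3', h4'⟩ <;>
      omega

theorem ch_spec (x w : V) (hx : d.dep x = 2) (hw : d.dep w = 1) (hp : d.pos w = d.pos x) :
    d.dep (d.ch w) = 2 ∧ d.par (d.ch w) = w ∧ d.pos (d.ch w) = d.pos w := by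
  have h := d.hunif x w hx hw hp
  have e : d.ch w = h.choose := by unfold ch; rw [dif_pos h]
  have hs := h.choose_spec
  rw [← e] at hs
  refine ⟨hs.1, hs.2, ?_⟩
  have := (d.hpar (d.ch w) (by omega)).2.1
  rw [hs.2] at this
  exact this.symm

variable [Fintype V]

theorem fill_ecc (hG : G.Connected) (hk : 1 ≤ k) (z : V) : d.fill z ≤ ecc G z := by
  rcases Nat.eq_zero_or_pos (d.fill z) with h | h
  · omega
  have key : ∀ j ≤ k, d.pos z ≠ j → d.fill z ≤ ecc G z := by
    intro j hj hne
    have hv := d.hv j hj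
    have h1 := d.dist_lower hG z (d.v j) (by rw [hv.1]; exact hne)
    have h2 : G.dist z (d.v j) ≤ ecc G z :=
      Finset.le_sup (f := fun u => G.dist z u) (Finset.mem_univ (d.v j))
    have : 1 ≤ |(d.pos z : ℤ) - d.pos (d.v j)| := by
      apply Int.one_le_abs
      rw [hv.1]
      omega
    rcases d.fill_cases z h with ⟨h1, h2, h3⟩ | ⟨h1, h2, h3, h4⟩ <;> omega
  by_cases h0 : d.pos z = 0
  · exact key 1 hk (by omega)
  · exact key 0 (by omega) h0

theorem fill_sum (j : ℕ) (hj : j ≤ k) :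
    2 + (if d.is2 j then 4 else 0) ≤ ∑ z with d.pos z = j, d.fill z := by
  obtain ⟨w₁, w₂, hne, h1, h2, p1, p2⟩ := d.htwo j hj
  have key : ∀ a b : V, a ≠ b → d.pos a = j → d.pos b = j →
      d.fill a + d.fill b ≤ ∑ z with d.pos z = j, d.fill z := by
    intro a b hab ha hb
    rw [← Finset.sum_pair hab]
    apply Finset.sum_le_sum_of_subset
    intro z hz
    simp only [Finset.mem_insert, Finset.mem_singleton] at hz
    rcases hz with rfl | rfl <;> simpa
  split_ifs with h
  · obtain ⟨x, hx, px⟩ := h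
    obtain ⟨a1, a2, a3⟩ := d.ch_spec x w₁ hx h1 (by omega)
    obtain ⟨b1, b2, b3⟩ := d.ch_spec x w₂ hx h2 (by omega)
    have hab : d.ch w₁ ≠ d.ch w₂ := by
      intro hh
      rw [hh, b2] at a2
      exact hne a2.symm
    have := key _ _ hab (by omega) (by omega)
    have f1 : d.fill (d.ch w₁) = 3 := by unfold fill; simp [a1, a2]
    have f2 : d.fill (d.ch w₂) = 3 := by unfold fill; simp [b1, b2]
    omega
  · have := key _ _ hne p1 p2
    have f1 : d.fill w₁ = 1 := by unfold fill; simp [h1, p1, h]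
    have f2 : d.fill w₂ = 1 := by unfold fill; simp [h2, p2, h]
    omega

/-- Vertices with a big broadcast value. -/
def big (f : V → ℕ) (x : V) : Prop := 4 ≤ f x ∨ (d.dep x = 0 ∧ 2 ≤ f x)

/-- Radius of the refilled region. -/
def rad (f : V → ℕ) (x : V) : ℕ := if d.dep x = 0 then (f x - 1) / 2 else f x / 2 - d.dep x

theorem ecc_le (hG : G.Connected) (x : V) : ecc G x ≤ d.dep x + 2 + k := by
  apply Finset.sup_le
  intro u _
  have h1 := d.dist_upper hG x u
  have h2 := d.hdep u
  have h3 := d.hpos u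
  have h4 := d.hpos x
  have : |(d.pos x : ℤ) - d.pos u| ≤ k := by rw [abs_le]; constructor <;> omega
  omega

theorem region_sum (hG : G.Connected) (hk : 1 ≤ k) (f : V → ℕ) (hf : IsBroadcast G f) (x : V)
    (hx : d.big f x) :
    f x ≤ ∑ z with (d.pos z ≤ d.pos x + d.rad f x ∧ d.pos x ≤ d.pos z + d.rad f x),
      d.fill z := by
  set r := d.rad f x with hr
  set i := d.pos x with hi
  have hik : i ≤ k := d.hpos x
  have hd := d.hdep x
  have he : f x ≤ d.dep x + 2 + k := (hf x).trans (d.ecc_le hG x)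
  set J := Finset.Icc (i - r) (min (i + r) k) with hJ
  have e1 : ∑ z with (d.pos z ≤ i + r ∧ i ≤ d.pos z + r), d.fill z
      = ∑ j ∈ J, ∑ z with d.pos z = j, d.fill z := by
    rw [← Finset.sum_fiberwise_of_maps_to (t := J) (g := d.pos)]
    · apply Finset.sum_congr rfl
      intro j hj
      rw [Finset.filter_filter]
      apply Finset.sum_congr _ (fun _ _ => rfl)
      ext z
      simp only [hJ, Finset.mem_Icc] at hj
      simp only [Finset.mem_filter, Finset.mem_univ, true_and]
      omega
    · intro z hz
      have := d.hpos z
      simp only [Finset.mem_filter, Finset.mem_univ, true_and] at hz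
      simp only [hJ, Finset.mem_Icc]
      omega
  have key : ∀ T : Finset ℕ, T ⊆ J → (∀ j ∈ T, d.is2 j) → 2 * J.card + 4 * T.card ≤
      ∑ j ∈ J, ∑ z with d.pos z = j, d.fill z := by
    intro T hT h2
    calc 2 * J.card + 4 * T.card = ∑ j ∈ J, (2 + if j ∈ T then 4 else 0) := by
          rw [Finset.sum_add_distrib, Finset.sum_ite_mem, Finset.inter_eq_right.2 hT]
          simp [mul_comm]
      _ ≤ _ := by
          apply Finset.sum_le_sum
          intro j hj
          simp only [hJ, Finset.mem_Icc] at hj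
          refine le_trans ?_ (d.fill_sum j (by omega))
          by_cases h : j ∈ T
          · simp [h, h2 j h]
          · simp [h]
  rw [e1]
  have hcard : J.card = min (i + r) k + 1 - (i - r) := by rw [hJ, Nat.card_Icc]
  have hrr : (d.dep x = 0 ∧ r = (f x - 1) / 2) ∨ (d.dep x ≠ 0 ∧ r = f x / 2 - d.dep x) := by
    rw [hr]; unfold rad; split_ifs with h <;> simp [h]
  have hbig : 4 ≤ f x ∨ (d.dep x = 0 ∧ 2 ≤ f x) := hx
  have m0 : i ≤ r → 0 ∈ J := by intro h; simp only [hJ, Finset.mem_Icc]; omega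
  have mk : k ≤ i + r → k ∈ J := by intro h; simp only [hJ, Finset.mem_Icc]; omega
  by_cases h0 : i ≤ r
  · by_cases h1 : k ≤ i + r
    · have := key {0, k} (by
        intro j hj
        simp only [Finset.mem_insert, Finset.mem_singleton] at hj
        rcases hj with rfl | rfl
        · exact m0 h0
        · exact mk h1) (by
        intro j hj
        simp only [Finset.mem_insert, Finset.mem_singleton] at hj
        rcases hj with rfl | rfl
        · exact d.hend0
        · exact d.hendk)
      rw [Finset.card_pair (by omega)] at this
      omega
    · have := key {0} (by simpa using m0 h0) (by intro j hj; rw [Finset.mem_singleton.1 hj]; exact d.hend0)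
      rw [Finset.card_singleton] at this
      omega
  · by_cases h1 : k ≤ i + r
    · have := key {k} (by simpa using mk h1) (by intro j hj; rw [Finset.mem_singleton.1 hj]; exact d.hendk)
      rw [Finset.card_singleton] at this
      omega
    · by_cases h2 : d.dep x = 2
      · have := key {i} (by simp [hJ]; omega) (by simpa using ⟨x, h2, hi.symm⟩)
        rw [Finset.card_singleton] at this
        omega
      · have := key ∅ (by simp) (by simp)
        rw [Finset.card_empty] at this
        omega

theorem core (hG : G.Connected) (hk : 1 ≤ k) (f : V → ℕ) (hf : IsIndepBroadcast G f) :
    ∃ g : V → ℕ, IsIndepBroadcast G g ∧ bcost f ≤ bcost g ∧ (∀ x, g x ≤ 3) ∧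
      ∀ x, d.dep x = 0 → g x ≤ 1 := by
  obtain ⟨hfb, hfi⟩ := hf
  let near : V → V → Prop := fun x z =>
    d.pos z ≤ d.pos x + d.rad f x ∧ d.pos x ≤ d.pos z + d.rad f x
  let R : V → Prop := fun z => ∃ x, d.big f x ∧ near x z
  have hrr : ∀ x, (d.dep x = 0 ∧ d.rad f x = (f x - 1) / 2) ∨
      (d.dep x ≠ 0 ∧ d.rad f x = f x / 2 - d.dep x) := by
    intro x; unfold rad; split_ifs with h <;> simp [h]
  -- a positive small vertex is far from every region
  have hfar : ∀ x y, d.big f x → ¬ d.big f y → 0 < f y →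
      ((d.dep y : ℤ) + |(d.pos x : ℤ) - d.pos y| ≥ d.rad f x + 3) := by
    intro x y hx hy hy0
    have hne : x ≠ y := by rintro rfl; exact hy hx
    have hb : 4 ≤ f x ∨ (d.dep x = 0 ∧ 2 ≤ f x) := hx
    have h1 := hfi x y hne (by omega) hy0
    have h2 := d.dist_upper hG x y
    have h3 := hrr x
    have h4 := d.hdep x
    omega
  have hdisj : ∀ x y, d.big f x → d.big f y → x ≠ y →
      ((d.rad f x : ℤ) + d.rad f y < |(d.pos x : ℤ) - d.pos y|) := by
    intro x y hx hy hne
    have hb : 4 ≤ f x ∨ (d.dep x = 0 ∧ 2 ≤ f x) := hx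
    have hb' : 4 ≤ f y ∨ (d.dep y = 0 ∧ 2 ≤ f y) := hy
    have h1 := hfi x y hne (by omega) (by omega)
    have h2 := d.dist_upper hG x y
    have h3 := hrr x
    have h3' := hrr y
    have h4 := d.hdep x
    have h4' := d.hdep y
    omega
  have hbigR : ∀ x, d.big f x → R x := fun x hx => ⟨x, hx, by constructor <;> omega⟩
  have hsmall : ∀ y, R y → ¬ d.big f y → f y = 0 := by
    rintro y ⟨x, hx, h1, h2⟩ hy
    by_contra h0
    have := hfar x y hx hy (by omega)
    have h4 := d.hdep y
    have : |(d.pos x : ℤ) - d.pos y| ≤ d.rad f x := by rw [abs_le]; constructor <;> omega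
    omega
  let g : V → ℕ := fun z => if R z then d.fill z else f z
  have gR : ∀ z, R z → g z = d.fill z := fun z hz => if_pos hz
  have gN : ∀ z, ¬ R z → g z = f z := fun z hz => if_neg hz
  have hN : ∀ z, ¬ R z → ¬ (4 ≤ f z ∨ (d.dep z = 0 ∧ 2 ≤ f z)) :=
    fun z hz hb => hz (hbigR z hb)
  have hmix : ∀ z y, R z → ¬ R y → 0 < d.fill z → 0 < f y →
      max (d.fill z) (f y) < G.dist z y := by
    rintro z y ⟨x, hx, h1, h2⟩ hy hz0 hy0
    have hys := hN y hy
    have hfr := hfar x y hx hys hy0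
    have h4 := d.hdep y
    have hzx : |(d.pos x : ℤ) - d.pos z| ≤ d.rad f x := by rw [abs_le]; constructor <;> omega
    have hne : d.pos z ≠ d.pos y := by
      intro h
      rw [h] at hzx
      omega
    have hl := d.dist_lower hG z y hne
    have htri : |(d.pos x : ℤ) - d.pos y| ≤ |(d.pos x : ℤ) - d.pos z| + |(d.pos z : ℤ) - d.pos y| :=
      abs_sub_le _ _ _
    rcases d.fill_cases z hz0 with ⟨c1, c2, c3⟩ | ⟨c1, c2, c3, c4⟩ <;> omega
  refine ⟨g, ⟨?_, ?_⟩, ?_, ?_, ?_⟩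
  · intro z
    by_cases hz : R z
    · rw [gR z hz]; exact d.fill_ecc hG hk z
    · rw [gN z hz]; exact hfb z
  · intro a b hab ha hb
    by_cases hRa : R a <;> by_cases hRb : R b
    · rw [gR a hRa] at *; rw [gR b hRb] at *
      exact d.fill_indep hG a b hab ha hb
    · rw [gR a hRa] at *; rw [gN b hRb] at *
      exact hmix a b hRa hRb ha hb
    · rw [gN a hRa] at *; rw [gR b hRb] at *
      rw [max_comm, SimpleGraph.dist_comm]
      exact hmix b a hRb hRa hb ha
    · rw [gN a hRa] at *; rw [gN b hRb] at *
      exact hfi a b hab ha hb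
  · unfold bcost
    rw [← Finset.sum_filter_add_sum_filter_not Finset.univ R f,
      ← Finset.sum_filter_add_sum_filter_not Finset.univ R g]
    apply add_le_add
    · have e1 : ∑ z with R z, f z = ∑ x with d.big f x, f x := by
        symm
        apply Finset.sum_subset
        · intro x hx
          simp only [Finset.mem_filter, Finset.mem_univ, true_and] at hx ⊢
          exact hbigR x hx
        · intro y hy hy'
          simp only [Finset.mem_filter, Finset.mem_univ, true_and] at hy hy'
          exact hsmall y hy hy'
      have e2 : ∑ z with R z, g z = ∑ x with d.big f x, ∑ z with near x z, d.fill z := by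
        rw [← Finset.sum_biUnion]
        · apply Finset.sum_congr
          · ext z
            simp [R]
          · intro z hz
            simp only [Finset.mem_biUnion, Finset.mem_filter, Finset.mem_univ, true_and] at hz
            exact gR z hz
        · intro x hx y hy hxy
          simp only [Finset.coe_filter, Finset.mem_univ, true_and, Set.mem_ofPred_eq] at hx hy
          have := hdisj x y hx hy hxy
          rw [Function.onFun, Finset.disjoint_left]
          intro z hz hz'
          simp only [Finset.mem_filter, Finset.mem_univ, true_and, near] at hz hz'
          have : |(d.pos x : ℤ) - d.pos y| ≤ d.rad f x + d.rad f y := by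
            rw [abs_le]; constructor <;> omega
          omega
      rw [e1, e2]
      apply Finset.sum_le_sum
      intro x hx
      simp only [Finset.mem_filter, Finset.mem_univ, true_and] at hx
      exact d.region_sum hG hk f hfb x hx
    · apply Finset.sum_le_sum
      intro z hz
      simp only [Finset.mem_filter, Finset.mem_univ, true_and] at hz
      rw [gN z hz]
  · intro z
    by_cases hz : R z
    · rw [gR z hz]
      unfold fill; split_ifs <;> omega
    · rw [gN z hz]; have := hN z hz; omega
  · intro z hd0
    by_cases hz : R z
    · rw [gR z hz]
      unfold fill; split_ifs <;> omega
    · rw [gN z hz]; have := hN z hz; omega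

end LobData

theorem leaf_iff {W : Type*} (H : SimpleGraph W) (v : W) :
    H.IsLeafVert v ↔ ∃ u, H.Adj v u ∧ ∀ z, H.Adj v z → z = u := by
  unfold SimpleGraph.IsLeafVert
  rw [Set.ncard_eq_one]
  constructor
  · rintro ⟨u, hu⟩
    have h : ∀ z, H.Adj v z ↔ z = u := by
      intro z
      rw [← SimpleGraph.mem_neighborSet, hu, Set.mem_singleton_iff]
    exact ⟨u, (h u).2 rfl, fun z hz => (h z).1 hz⟩
  · rintro ⟨u, hu, hz⟩
    refine ⟨u, ?_⟩
    ext z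
    rw [SimpleGraph.mem_neighborSet, Set.mem_singleton_iff]
    exact ⟨hz z, fun h => h ▸ hu⟩

/-- In a connected graph with a non-leaf, the neighbour of a leaf is not a leaf. -/
theorem leaf_nbr_nonleaf {W : Type*} (H : SimpleGraph W) (hH : H.Connected) {a v u : W}
    (ha : ¬ H.IsLeafVert a) (hv : H.IsLeafVert v) (hvu : H.Adj v u) : ¬ H.IsLeafVert u := by
  intro hu
  have hv' := hv
  have hu' := hu
  rw [leaf_iff] at hv' hu'
  obtain ⟨p, hp, hp'⟩ := hv'
  obtain ⟨q, hq, hq'⟩ := hu'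
  have e1 : u = p := hp' u hvu
  have e2 : v = q := hq' v hvu.symm
  have key : ∀ x y : W, H.Walk x y → (x = v ∨ x = u) → (y = v ∨ y = u) := by
    intro x y w
    induction w with
    | nil => exact id
    | cons h w ih =>
      intro hx
      apply ih
      rcases hx with rfl | rfl
      · right; rw [e1]; exact hp' _ h
      · left; rw [e2]; exact hq' _ h
  obtain ⟨w⟩ := hH.preconnected v a
  rcases key v a w (Or.inl rfl) with rfl | rfl
  · exact ha hv
  · exact ha hu

theorem two_nbrs {W : Type*} (H : SimpleGraph W) {v u : W} (hv : ¬ H.IsLeafVert v)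
    (hvu : H.Adj v u) : ∃ z, H.Adj v z ∧ z ≠ u := by
  by_contra hcon
  push Not at hcon
  exact hv ((leaf_iff H v).2 ⟨u, hvu, hcon⟩)

theorem exists_lobData {G : SimpleGraph V} {k : ℕ} (hk : 1 ≤ k)
    (hL : IsLobster G) (s : SpineEnum G k) (hlu : LocallyUniform G s)
    (h2 : IsTwoLobster G s) : ∃ d : LobData G k, d.v = s.v := by
  have hG : G.Connected := hL.1.1
  have hH : (pruned G).Connected := hL.2.1.1
  let N : V → Prop := fun x => ¬ G.IsLeafVert x
  let S : V → Prop := fun x => x ∈ spineSet G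
  have hSv : ∀ i ≤ k, S (s.v i) := fun i hi => (s.mem _).2 ⟨i, hi, rfl⟩
  have hSN : ∀ x, S x → N x := fun x hx => hx.1
  obtain ⟨h0N, h0S⟩ := hSv 0 (Nat.zero_le k)
  -- every non-spine vertex has a unique non-leaf neighbour
  have hA : ∀ x, ¬ S x → N x → ∃ u, G.Adj x u ∧ S u ∧ ∀ z, G.Adj x z → N z → z = u := by
    intro x hx hN
    have hl : (pruned G).IsLeafVert ⟨x, hN⟩ := by
      by_contra h
      exact hx ⟨hN, h⟩
    have hl' := hl
    rw [leaf_iff] at hl'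
    obtain ⟨⟨u, huN⟩, hu, hz⟩ := hl'
    refine ⟨u, hu, ⟨huN, leaf_nbr_nonleaf (pruned G) hH h0S hl hu⟩, ?_⟩
    intro z hxz hzN
    have := hz ⟨z, hzN⟩ hxz
    exact congrArg Subtype.val this
  have hB : ∀ x, ¬ N x → ∃ u, G.Adj x u ∧ N u ∧ ∀ z, G.Adj x z → z = u := by
    intro x hx
    have hl : G.IsLeafVert x := by
      by_contra h
      exact hx h
    have hl' := hl
    rw [leaf_iff] at hl'
    obtain ⟨u, hu, hz⟩ := hl'
    exact ⟨u, hu, leaf_nbr_nonleaf G hG h0N hl hu, hz⟩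
  have hP : ∀ x, ∃ u, ¬ S x → (G.Adj x u ∧ N u ∧ ∀ z, G.Adj x z → N z → z = u) := by
    intro x
    by_cases hx : S x
    · exact ⟨x, fun h => absurd hx h⟩
    · by_cases hN : N x
      · obtain ⟨u, h1, h2, h3⟩ := hA x hx hN
        exact ⟨u, fun _ => ⟨h1, hSN u h2, h3⟩⟩
      · obtain ⟨u, h1, h2, h3⟩ := hB x hN
        exact ⟨u, fun _ => ⟨h1, h2, fun z hz _ => h3 z hz⟩⟩
  choose par hpar using hP
  have hI : ∀ x, ∃ i, S x → (i ≤ k ∧ s.v i = x) := by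
    intro x
    by_cases hx : S x
    · obtain ⟨i, hi⟩ := (s.mem x).1 hx
      exact ⟨i, fun _ => hi⟩
    · exact ⟨0, fun h => absurd h hx⟩
  choose idx hidx using hI
  have idx_v : ∀ i ≤ k, idx (s.v i) = i := by
    intro i hi
    have := hidx (s.v i) (hSv i hi)
    exact s.inj _ this.1 _ hi this.2
  have hparS : ∀ x, ¬ S x → N x → S (par x) := by
    intro x hx hN
    obtain ⟨u, h1, h2, h3⟩ := hA x hx hN
    have := h3 (par x) (hpar x hx).1 (hpar x hx).2.1
    rw [this]; exact h2
  have hparpar : ∀ x, ¬ S x → ¬ S (par x) → S (par (par x)) :=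
    fun x hx hpx => hparS _ hpx (hpar x hx).2.1
  let dep : V → ℕ := fun x => if S x then 0 else if S (par x) then 1 else 2
  let pos : V → ℕ := fun x => if S x then idx x else if S (par x) then idx (par x)
    else idx (par (par x))
  have d0 : ∀ x, S x → dep x = 0 ∧ pos x = idx x := by
    intro x hx; simp [dep, pos, hx]
  have d1 : ∀ x, ¬ S x → S (par x) → dep x = 1 ∧ pos x = idx (par x) := by
    intro x hx hp; simp [dep, pos, hx, hp]
  have d2 : ∀ x, ¬ S x → ¬ S (par x) → dep x = 2 ∧ pos x = idx (par (par x)) := by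
    intro x hx hp; simp [dep, pos, hx, hp]
  have dc : ∀ x, (S x ∧ dep x = 0 ∧ pos x = idx x) ∨
      (¬ S x ∧ S (par x) ∧ dep x = 1 ∧ pos x = idx (par x)) ∨
      (¬ S x ∧ ¬ S (par x) ∧ dep x = 2 ∧ pos x = idx (par (par x))) := by
    intro x
    by_cases h : S x
    · exact Or.inl ⟨h, d0 x h⟩
    · by_cases h' : S (par x)
      · exact Or.inr (Or.inl ⟨h, h', d1 x h h'⟩)
      · exact Or.inr (Or.inr ⟨h, h', d2 x h h'⟩)
  have e0 : ∀ x, dep x = 0 → S x := by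
    intro x hx; rcases dc x with h | h | h
    · exact h.1
    · omega
    · omega
  have e1 : ∀ x, dep x = 1 → ¬ S x ∧ S (par x) ∧ pos x = idx (par x) := by
    intro x hx; rcases dc x with h | h | h
    · omega
    · exact ⟨h.1, h.2.1, h.2.2.2⟩
    · omega
  have e2 : ∀ x, dep x = 2 → ¬ S x ∧ ¬ S (par x) ∧ pos x = idx (par (par x)) := by
    intro x hx; rcases dc x with h | h | h
    · omega
    · omega
    · exact ⟨h.1, h.2.1, h.2.2.2⟩
  have n2 : ∀ x, dep x = 2 → ¬ N x := by
    intro x hx hN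
    exact (e2 x hx).2.1 (hparS x (e2 x hx).1 hN)
  -- a non-spine neighbour of a spine vertex
  have nb : ∀ a b, G.Adj a b → S a → ¬ S b → par b = a ∧ dep b = 1 ∧ pos b = pos a := by
    intro a b hab ha hb
    have hp : par b = a := ((hpar b hb).2.2 a hab.symm (hSN a ha)).symm
    have := d1 b hb (by rw [hp]; exact ha)
    refine ⟨hp, this.1, ?_⟩
    rw [this.2, (d0 a ha).2, hp]
  -- an edge off the spine
  have nc : ∀ a b, G.Adj a b → ¬ S a → ¬ S b → N a →
      par b = a ∧ dep b = 2 ∧ dep a = 1 ∧ pos b = pos a := by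
    intro a b hab ha hb hN
    have hp : par b = a := ((hpar b hb).2.2 a hab.symm hN).symm
    have h1 := d2 b hb (by rw [hp]; exact ha)
    have h2 := d1 a ha (hparS a ha hN)
    refine ⟨hp, h1.1, h2.1, ?_⟩
    rw [h1.2, h2.2, hp]
  have hparD : ∀ x, 0 < dep x → G.Adj x (par x) ∧ pos (par x) = pos x ∧
      dep (par x) + 1 = dep x := by
    intro x hx
    rcases dc x with h | h | h
    · omega
    · have h' := hpar x h.1
      have := d0 (par x) h.2.1
      exact ⟨h'.1, by omega, by omega⟩
    · have h' := hpar x h.1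
      have := d1 (par x) h.2.1 (hparpar x h.1 h.2.1)
      exact ⟨h'.1, by omega, by omega⟩
  have leafdep : ∀ x, dep x = 1 → (¬ ∃ c, dep c = 2 ∧ par c = x) → G.IsLeafVert x := by
    intro x hx hc
    by_contra hN
    obtain ⟨hxS, hpS, _⟩ := e1 x hx
    obtain ⟨z, hz, hzne⟩ := two_nbrs G hN (hpar x hxS).1
    by_cases hzS : S z
    · exact hzne ((hpar x hxS).2.2 z hz (hSN z hzS))
    · have := nc x z hz hxS hzS hN
      exact hc ⟨z, this.2.1, this.1⟩
  have offadj : ∀ a b, (offSpine G).Adj a b ↔ G.Adj a b ∧ ¬ (S a ∧ S b) := by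
    intro a b
    unfold offSpine
    rw [SimpleGraph.deleteEdges_adj]
    simp [S]
  have reach : ∀ x, 0 < dep x → (offSpine G).Adj (par x) x := by
    intro x hx
    rw [offadj]
    refine ⟨(hparD x hx).1.symm, ?_⟩
    rintro ⟨_, h⟩
    have := (d0 x h).1
    omega
  have par1 : ∀ x, dep x = 1 → par x = s.v (pos x) := by
    intro x hx
    obtain ⟨_, h1, h2⟩ := e1 x hx
    rw [h2]; exact (hidx _ h1).2.symm
  have hposk : ∀ x, pos x ≤ k := by
    intro x
    rcases dc x with h | h | h
    · rw [h.2.2]; exact (hidx _ h.1).1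
    · rw [h.2.2.2]; exact (hidx _ h.2.1).1
    · rw [h.2.2.2]; exact (hidx _ (hparpar x h.1 h.2.1)).1
  have hend : ∀ i ≤ k, ∀ j ≤ k, G.Adj (s.v i) (s.v j) →
      (∀ m ≤ k, G.Adj (s.v i) (s.v m) → m = j) → ∃ x, dep x = 2 ∧ pos x = i := by
    intro i hi j hj hij huniq
    obtain ⟨hiN, hiS⟩ := hSv i hi
    obtain ⟨⟨b, hbN⟩, hb, hbne⟩ := two_nbrs (pruned G) hiS
      (u := ⟨s.v j, hSN _ (hSv j hj)⟩) hij
    have hb' : G.Adj (s.v i) b := hb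
    have hbS : ¬ S b := by
      intro hbS
      obtain ⟨m, hm, hmb⟩ := (s.mem b).1 hbS
      subst hmb
      have := huniq m hm hb'
      subst this
      exact hbne rfl
    have hbb := nb _ _ hb' (hSv i hi) hbS
    obtain ⟨c, hc, hcne⟩ := two_nbrs G hbN hb'.symm
    have hcS : ¬ S c := by
      intro hcS
      have h1 := (hpar b hbS).2.2 c hc (hSN c hcS)
      rw [hbb.1] at h1
      exact hcne h1
    have hcc := nc b c hc hbS hcS hbN
    refine ⟨c, hcc.2.1, ?_⟩
    rw [hcc.2.2.2, hbb.2.2, (d0 _ (hSv i hi)).2, idx_v i hi]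
  refine ⟨⟨s.v, pos, dep, par, hposk, ?_, ?_, ?_, ?_, hparD, ?_, ?_, ?_, ?_, ?_, ?_⟩, rfl⟩
  · intro x
    rcases dc x with h | h | h <;> omega
  · intro i hi
    have := d0 _ (hSv i hi)
    rw [idx_v i hi] at this
    exact ⟨this.2, this.1⟩
  · intro x hx
    have hS := e0 x hx
    rw [(d0 x hS).2]
    exact (hidx x hS).2.symm
  · intro i hi
    exact (s.adj i (by omega) (i + 1) (by omega)).2 (Or.inl rfl)
  · intro a b hab
    by_cases ha : S a <;> by_cases hb : S b
    · left
      have a1 := d0 a ha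
      have b1 := d0 b hb
      have ai := hidx a ha
      have bi := hidx b hb
      refine ⟨a1.1, b1.1, ?_⟩
      rw [a1.2, b1.2]
      apply (s.adj _ ai.1 _ bi.1).1
      rw [ai.2, bi.2]
      exact hab
    · right
      have := nb a b hab ha hb
      have := d0 a ha
      omega
    · right
      have := nb b a hab.symm hb ha
      have := d0 b hb
      omega
    · right
      by_cases hN : N a
      · have := nc a b hab ha hb hN
        omega
      · obtain ⟨u, h1, h2, h3⟩ := hB a hN
        have hbu := h3 b hab
        subst hbu
        have := nc b a hab.symm hb ha h2
        omega
  · intro x y hx hxy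
    obtain ⟨u, h1, h2, h3⟩ := hB x (n2 x hx)
    rw [h3 y hxy, h3 (par x) (hparD x (by omega)).1]
  · intro x w hx hw hpw
    by_contra hc
    have hwl := leafdep w hw hc
    have hxl : G.IsLeafVert x := by
      by_contra h
      exact n2 x hx h
    have px := hparD x (by omega)
    have hpx1 : dep (par x) = 1 := by omega
    have hpp : par (par x) = s.v (pos x) := by rw [par1 _ hpx1, px.2.1]
    have rx : x ∈ Ssub G (s.v (pos x)) := by
      have r1 := reach (par x) (by omega)
      have r2 := reach x (by omega)
      rw [hpp] at r1
      exact r1.reachable.trans r2.reachable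
    have hpw' : par w = s.v (pos x) := by rw [par1 w hw, hpw]
    have rw' : w ∈ Ssub G (s.v (pos x)) := by
      have r1 := reach w (by omega)
      rw [hpw'] at r1
      exact r1.reachable
    rcases hlu (pos x) (hposk x) with h | h
    · have := SimpleGraph.dist_eq_one_iff_adj.1 (h x rx hxl)
      have h3 := nb _ _ this (hSv _ (hposk x)) (e2 x hx).1
      omega
    · have h4 := h w rw' hwl
      have h5 : G.dist (s.v (pos x)) w = 1 := by
        rw [SimpleGraph.dist_eq_one_iff_adj, ← hpw']
        exact (hparD w (by omega)).1.symm
      omega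
  · apply hend 0 (by omega) 1 hk
    · exact (s.adj 0 (by omega) 1 hk).2 (Or.inl rfl)
    · intro m hm h
      have := (s.adj 0 (by omega) m hm).1 h
      omega
  · apply hend k le_rfl (k - 1) (by omega)
    · exact (s.adj k le_rfl (k - 1) (by omega)).2 (Or.inr (by omega))
    · intro m hm h
      have := (s.adj k le_rfl m hm).1 h
      omega
  · intro i hi
    have hc := h2 i hi
    obtain ⟨w₁, hw₁, w₂, hw₂, hne⟩ := (Set.one_lt_ncard_iff_nontrivial_and_finite.1
      (show 1 < (branchRoots G (s.v i)).ncard by omega)).1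
    have key : ∀ w ∈ branchRoots G (s.v i), dep w = 1 ∧ pos w = i := by
      intro w hw
      have hw' : (offSpine G).Adj (s.v i) w := hw
      rw [offadj] at hw'
      have := nb _ _ hw'.1 (hSv i hi) (fun h => hw'.2 ⟨hSv i hi, h⟩)
      rw [(d0 _ (hSv i hi)).2, idx_v i hi] at this
      exact this.2
    exact ⟨w₁, w₂, hne, (key w₁ hw₁).1, (key w₂ hw₂).1, (key w₁ hw₁).2, (key w₂ hw₂).2⟩

/-- if `L` is a locally uniform 2-lobster of length `k ≥ 1` and `f`
is an optimal independent broadcast on `L`, then there exists an optimal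
independent broadcast `g` on `L` such that for every spine-subtree `S_i` and
every vertex `x` of `S_i`: `g x ≤ 1` if `x = v_i`, `g x ≤ 3` if `x` is a 1-leaf
of `S_i`, and `g x ≤ 4` if `x` is a 2-leaf of `S_i`. -/
theorem stmt16 {V : Type*} [Fintype V] (G : SimpleGraph V) (k : ℕ) (hk : 1 ≤ k)
    (hL : IsLobster G) (s : SpineEnum G k) (hlu : LocallyUniform G s)
    (h2 : IsTwoLobster G s)
    (f : V → ℕ) (hf : IsIndepBroadcast G f) (hopt : bcost f = betaB G) :
    ∃ g : V → ℕ, IsIndepBroadcast G g ∧ bcost g = betaB G ∧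
      ∀ i ≤ k, g (s.v i) ≤ 1 ∧
        ∀ x ∈ Ssub G (s.v i), G.IsLeafVert x →
          (G.dist (s.v i) x = 1 → g x ≤ 3) ∧ (G.dist (s.v i) x = 2 → g x ≤ 4) := by
  have hG : G.Connected := hL.1.1
  obtain ⟨d, hd⟩ := exists_lobData hk hL s hlu h2
  obtain ⟨g, hg, hcost, h3, h1⟩ := d.core hG hk f hf
  have hbdd : BddAbove {c : ℕ | ∃ f : V → ℕ, IsIndepBroadcast G f ∧ bcost f = c} := by
    refine ⟨∑ v, ecc G v, ?_⟩
    rintro c ⟨f', hf', rfl⟩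
    exact Finset.sum_le_sum fun v _ => hf'.1 v
  have hle : bcost g ≤ betaB G := le_csSup hbdd ⟨g, hg, rfl⟩
  refine ⟨g, hg, le_antisymm hle (hopt ▸ hcost), ?_⟩
  intro i hi
  refine ⟨h1 _ (hd ▸ (d.hv i hi).2), ?_⟩
  intro x _ _
  exact ⟨fun _ => h3 x, fun _ => (h3 x).trans (by norm_num)⟩
end
end
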